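/- For every m ≥ 1 and every m-tape Turing ω-machine M, there exists a single-tape Turing ω-machine M' such that L_{σ,ρ}(M) = L_{σ,ρ}(M') for every σ ∈ {ran, inf} and ρ ∈ {⊓, ⊆, =}. Consequently, 𝓛_{σ,ρ}(m-ω-TM) = 𝓛_{σ,ρ}(ω-TM) for every (σ,ρ). -/

import Mathlib

namespace OmegaFormal

/-- σ component of an acceptance mode: `ran` (occurs at least once)
or `inf` (occurs infinitely often). -/
inductive AccSigma | ran | inf
deriving DecidableEq

/-- ρ component of an acceptance mode: `cap` (nonempty intersection, ⊓),
`sub` (⊆) or `eq` (=). -/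
inductive AccRho | cap | sub | eq
deriving DecidableEq

/-- derivation mode: leftmost (`l`) or normal (`nl`). -/
inductive DerivMode | l | nl
deriving DecidableEq

/-- `sigmaSet σ f` is ran(f) resp. inf(f). -/
def sigmaSet {Q : Type _} : AccSigma → (ℕ → Q) → Set Q
  | .ran, f => Set.range f
  | .inf, f => {q | ∀ n : ℕ, ∃ m : ℕ, n ≤ m ∧ f m = q}

/-- the binary relation denoted by ρ. -/
def rhoRel {Q : Type _} : AccRho → Set Q → Set Q → Prop
  | .cap, A, B => (A ∩ B).Nonempty
  | .sub, A, B => A ⊆ B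
  | .eq,  A, B => A = B

/-- f is (σ,ρ)-accepting w.r.t. the set 𝓕 of designated sets. -/
def IsAccepting {Q : Type _} (σ : AccSigma) (ρ : AccRho) (𝓕 : Set (Set Q)) (f : ℕ → Q) : Prop :=
  ∃ F ∈ 𝓕, rhoRel ρ (sigmaSet σ f) F

/-- the finite word `l` coincides with the prefix of the ω-word `u`. -/
def MatchesPrefix {T : Type _} (l : List T) (u : ℕ → T) : Prop :=
  ∀ (k : ℕ) (h : k < l.length), l.get ⟨k, h⟩ = u k

/-- the maximal terminal prefix of a sentential form. -/
def termPrefix {N T : Type _} : List (N ⊕ T) → List T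
  | [] => []
  | (Sum.inl _) :: _ => []
  | (Sum.inr a) :: l => a :: termPrefix l

/-- A phrase structure ω-grammar `G = (N, T, P, S, 𝓕)`:
`N` nonterminals, `T` terminals, `P` named productions `p : lhs p → rhs p`
with `lhs p ∈ N⁺`, `rhs p ∈ (N ∪ T)*`, start symbol, and
production repetition sets `acc ⊆ 2^P`. -/
structure OmegaPSG (T : Type) where
  N : Type
  [fintypeN : Fintype N]
  P : Type
  [fintypeP : Fintype P]
  lhs : P → List N
  lhs_ne : ∀ p : P, lhs p ≠ []
  rhs : P → List (N ⊕ T)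
  start : N
  acc : Set (Set P)

namespace OmegaPSG

variable {T : Type} (G : OmegaPSG T)

/-- one (normal) rewriting step using production p. -/
def Step (p : G.P) (x y : List (G.N ⊕ T)) : Prop :=
  ∃ u v : List (G.N ⊕ T),
    x = u ++ (G.lhs p).map Sum.inl ++ v ∧ y = u ++ G.rhs p ++ v

/-- one leftmost rewriting step: the rewritten occurrence starts at the
leftmost nonterminal, i.e. everything to its left is terminal. -/
def LStep (p : G.P) (x y : List (G.N ⊕ T)) : Prop :=
  ∃ u v : List (G.N ⊕ T), (∀ s ∈ u, ∃ a : T, s = Sum.inr a) ∧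
    x = u ++ (G.lhs p).map Sum.inl ++ v ∧ y = u ++ G.rhs p ++ v

def StepOf : DerivMode → G.P → List (G.N ⊕ T) → List (G.N ⊕ T) → Prop
  | .l => G.LStep
  | .nl => G.Step

/-- `L_{σ,ρ,π}(G)`: ω-words admitting an infinite π-derivation from S whose
growing terminal prefixes spell the word and whose production sequence is
(σ,ρ)-accepting w.r.t. `G.acc`. -/
def Lang (σ : AccSigma) (ρ : AccRho) (π : DerivMode) : Set (ℕ → T) :=
  {u | ∃ (s : ℕ → List (G.N ⊕ T)) (d : ℕ → G.P),
    s 0 = [Sum.inl G.start] ∧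
    (∀ i : ℕ, G.StepOf π (d i) (s i) (s (i + 1))) ∧
    (∀ n : ℕ, ∃ i : ℕ, n ≤ (termPrefix (s i)).length) ∧
    (∀ i : ℕ, MatchesPrefix (termPrefix (s i)) u) ∧
    IsAccepting σ ρ G.acc d}

/-- context-free: every left-hand side is a single nonterminal. -/
def IsCFG : Prop := ∀ p : G.P, (G.lhs p).length = 1

/-- context-sensitive (monotonic): `|β| ≥ |α|` for every production. -/
def IsCSG : Prop := ∀ p : G.P, (G.lhs p).length ≤ (G.rhs p).length

/-- right linear: productions of the form `A → uB` or `A → u`, `u ∈ T*`. -/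
def IsRLG : Prop :=
  ∀ p : G.P, (G.lhs p).length = 1 ∧
    ∃ (w : List T) (B : Option G.N),
      G.rhs p = w.map Sum.inr ++ B.toList.map Sum.inl

/-- `G` is a grammar with `$`-boundary (PSG version): with `$` = `dollar`,
`S` = `S'`, every production has one of the forms
(1) α → β, α,β ∈ N⁺ (N = nonterminals other than `$`, `S`),
(2) S → $α, α ∈ N⁺, (3) $A → a$, (4) A → ε. -/
def HasDollarBoundary (dollar S' : G.N) : Prop :=
  dollar ≠ S' ∧ G.start = S' ∧
  ∀ p : G.P,
    ((dollar ∉ G.lhs p ∧ S' ∉ G.lhs p) ∧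
      ∃ β : List G.N, β ≠ [] ∧ dollar ∉ β ∧ S' ∉ β ∧ G.rhs p = β.map Sum.inl) ∨
    (G.lhs p = [S'] ∧ ∃ α : List G.N, α ≠ [] ∧ dollar ∉ α ∧ S' ∉ α ∧
      G.rhs p = Sum.inl dollar :: α.map Sum.inl) ∨
    (∃ A : G.N, A ≠ dollar ∧ A ≠ S' ∧ G.lhs p = [dollar, A] ∧
      ∃ a : T, G.rhs p = [Sum.inr a, Sum.inl dollar]) ∨
    (∃ A : G.N, A ≠ dollar ∧ A ≠ S' ∧ G.lhs p = [A] ∧ G.rhs p = [])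

/-- `G` is a grammar with `$`-boundary (CSG version): forms (1)-(3) only,
with `|α| ≤ |β|` in form (1). -/
def HasDollarBoundaryCSG (dollar S' : G.N) : Prop :=
  dollar ≠ S' ∧ G.start = S' ∧
  ∀ p : G.P,
    ((dollar ∉ G.lhs p ∧ S' ∉ G.lhs p) ∧
      ∃ β : List G.N, β ≠ [] ∧ dollar ∉ β ∧ S' ∉ β ∧ (G.lhs p).length ≤ β.length ∧
        G.rhs p = β.map Sum.inl) ∨
    (G.lhs p = [S'] ∧ ∃ α : List G.N, α ≠ [] ∧ dollar ∉ α ∧ S' ∉ α ∧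
      G.rhs p = Sum.inl dollar :: α.map Sum.inl) ∨
    (∃ A : G.N, A ≠ dollar ∧ A ≠ S' ∧ G.lhs p = [dollar, A] ∧
      ∃ a : T, G.rhs p = [Sum.inr a, Sum.inl dollar])

end OmegaPSG

/-- `𝓛_{σ,ρ,π}(X)` for the family `X` of ω-grammars over `T` satisfying `C`. -/
def GLang (T : Type) (C : OmegaPSG T → Prop) (σ : AccSigma) (ρ : AccRho) (π : DerivMode) :
    Set (Set (ℕ → T)) :=
  {L | ∃ G : OmegaPSG T, C G ∧ L = G.Lang σ ρ π}

/-- number of non-ε labels among `b 0, …, b (i-1)`. -/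
def someCount {A : Type _} (b : ℕ → Option A) (i : ℕ) : ℕ :=
  ((Finset.range i).filter fun j => (b j).isSome = true).card

/-- the (ε-allowing) label sequence `b` concatenates to the ω-word `u`. -/
def Spells {A : Type _} (b : ℕ → Option A) (u : ℕ → A) : Prop :=
  (∀ n : ℕ, ∃ i : ℕ, n ≤ someCount b i) ∧
  ∀ i : ℕ, ∀ a : A, b i = some a → a = u (someCount b i)

/-- A finite state ω-automaton `(Q, Σ, δ, q₀, 𝓕)`. -/
structure OmegaFSA (Sig : Type) where
  Q : Type
  [fintypeQ : Fintype Q]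
  init : Q
  trans : Q → Option Sig → Q → Prop
  acc : Set (Set Q)

/-- `L_{σ,ρ}(A)` for a finite state ω-automaton. -/
def OmegaFSA.Lang {Sig : Type} (A : OmegaFSA Sig) (σ : AccSigma) (ρ : AccRho) :
    Set (ℕ → Sig) :=
  {u | ∃ (r : ℕ → A.Q) (b : ℕ → Option Sig),
    r 0 = A.init ∧ (∀ i : ℕ, A.trans (r i) (b i) (r (i + 1))) ∧
    Spells b u ∧ IsAccepting σ ρ A.acc r}

/-- `𝓛_{σ,ρ}(ω-FSA)`. -/
def FSALang (Sig : Type) (σ : AccSigma) (ρ : AccRho) : Set (Set (ℕ → Sig)) :=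
  {L | ∃ A : OmegaFSA Sig, L = A.Lang σ ρ}

/-- A pushdown ω-automaton `(Q, Σ, Γ, δ, q₀, Z₀, 𝓕)`. -/
structure OmegaPDA (Sig : Type) where
  Q : Type
  [fintypeQ : Fintype Q]
  Γ : Type
  [fintypeΓ : Fintype Γ]
  init : Q
  Z0 : Γ
  trans : Q → Option Sig → Γ → Q → List Γ → Prop
  acc : Set (Set Q)

/-- `L_{σ,ρ}(D)` for a pushdown ω-automaton. -/
def OmegaPDA.Lang {Sig : Type} (D : OmegaPDA Sig) (σ : AccSigma) (ρ : AccRho) :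
    Set (ℕ → Sig) :=
  {u | ∃ (q : ℕ → D.Q) (st : ℕ → List D.Γ) (b : ℕ → Option Sig),
    q 0 = D.init ∧ st 0 = [D.Z0] ∧
    (∀ i : ℕ, ∃ (Z : D.Γ) (γ rest : List D.Γ),
      st i = Z :: rest ∧ D.trans (q i) (b i) Z (q (i + 1)) γ ∧ st (i + 1) = γ ++ rest) ∧
    Spells b u ∧ IsAccepting σ ρ D.acc q}

/-- `𝓛_{σ,ρ}(ω-PDA)`. -/
def PDALang (Sig : Type) (σ : AccSigma) (ρ : AccRho) : Set (Set (ℕ → Sig)) :=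
  {L | ∃ D : OmegaPDA Sig, L = D.Lang σ ρ}

/-- tape head moves. -/
inductive Move | L | R | S
deriving DecidableEq

def moveHead : Move → ℕ → ℕ
  | .L, n => n - 1
  | .R, n => n + 1
  | .S, n => n

/-- A single-tape Turing ω-machine `(Q, Σ, Γ, δ, q₀, 𝓕)` (Σ ⊆ Γ via `embed`). -/
structure OmegaTM (Sig : Type) where
  Q : Type
  [fintypeQ : Fintype Q]
  Γ : Type
  [fintypeΓ : Fintype Γ]
  embed : Sig → Γ
  embed_inj : Function.Injective embed
  init : Q
  trans : Q → Γ → Q → Γ → Move → Prop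
  acc : Set (Set Q)

/-- `L_{σ,ρ}(M)`: ω-words admitting a complete non-oscillating run whose state
sequence is (σ,ρ)-accepting. -/
def OmegaTM.Lang {Sig : Type} (M : OmegaTM Sig) (σ : AccSigma) (ρ : AccRho) :
    Set (ℕ → Sig) :=
  {u | ∃ (q : ℕ → M.Q) (tape : ℕ → ℕ → M.Γ) (pos : ℕ → ℕ),
    q 0 = M.init ∧ (∀ n : ℕ, tape 0 n = M.embed (u n)) ∧ pos 0 = 0 ∧
    (∀ i : ℕ, ∃ (g : M.Γ) (m : Move),
      M.trans (q i) (tape i (pos i)) (q (i + 1)) g m ∧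
      tape (i + 1) = Function.update (tape i) (pos i) g ∧
      pos (i + 1) = moveHead m (pos i)) ∧
    (∀ n : ℕ, ∃ i : ℕ, n ≤ pos i) ∧
    (∀ n : ℕ, ∃ i0 : ℕ, ∀ i : ℕ, i0 ≤ i → pos i ≠ n) ∧
    IsAccepting σ ρ M.acc q}

/-- `𝓛_{σ,ρ}(ω-TM)`. -/
def TMLang (Sig : Type) (σ : AccSigma) (ρ : AccRho) : Set (Set (ℕ → Sig)) :=
  {L | ∃ M : OmegaTM Sig, L = M.Lang σ ρ}

/-- An m-tape Turing ω-machine. -/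
structure OmegaMTM (m : ℕ) (Sig : Type) where
  Q : Type
  [fintypeQ : Fintype Q]
  Γ : Type
  [fintypeΓ : Fintype Γ]
  embed : Sig → Γ
  embed_inj : Function.Injective embed
  blank : Γ
  init : Q
  trans : Q → (Fin m → Γ) → Q → (Fin m → Γ) → (Fin m → Move) → Prop
  acc : Set (Set Q)

/-- `L_{σ,ρ}(M)` for an m-tape Turing ω-machine (`hm : 0 < m`; the input is on
the first tape, the other tapes are initially blank; the run must be complete
and non-oscillating on the first tape). -/
def OmegaMTM.Lang {m : ℕ} {Sig : Type} (M : OmegaMTM m Sig) (hm : 0 < m)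
    (σ : AccSigma) (ρ : AccRho) : Set (ℕ → Sig) :=
  {u | ∃ (q : ℕ → M.Q) (tape : ℕ → Fin m → ℕ → M.Γ) (pos : ℕ → Fin m → ℕ),
    q 0 = M.init ∧
    (∀ n : ℕ, tape 0 ⟨0, hm⟩ n = M.embed (u n)) ∧
    (∀ j : Fin m, j ≠ ⟨0, hm⟩ → ∀ n : ℕ, tape 0 j n = M.blank) ∧
    (∀ j : Fin m, pos 0 j = 0) ∧
    (∀ i : ℕ, ∃ (g : Fin m → M.Γ) (mv : Fin m → Move),
      M.trans (q i) (fun j => tape i j (pos i j)) (q (i + 1)) g mv ∧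
      (∀ j : Fin m, tape (i + 1) j = Function.update (tape i j) (pos i j) (g j)) ∧
      (∀ j : Fin m, pos (i + 1) j = moveHead (mv j) (pos i j))) ∧
    (∀ n : ℕ, ∃ i : ℕ, n ≤ pos i ⟨0, hm⟩) ∧
    (∀ n : ℕ, ∃ i0 : ℕ, ∀ i : ℕ, i0 ≤ i → pos i ⟨0, hm⟩ ≠ n) ∧
    IsAccepting σ ρ M.acc q}

/-- `𝓛_{σ,ρ}(m-ω-TM)`. -/
def MTMLang (Sig : Type) (m : ℕ) (hm : 0 < m) (σ : AccSigma) (ρ : AccRho) :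
    Set (Set (ℕ → Sig)) :=
  {L | ∃ M : OmegaMTM m Sig, L = M.Lang hm σ ρ}

/-- the ω-language `{aⁿbⁿ | n ≥ 1}^ω` over the alphabet `Bool`
(`false` = a, `true` = b). -/
def abLang : Set (ℕ → Bool) :=
  {u | ∃ n : ℕ → ℕ, (∀ i : ℕ, 1 ≤ n i) ∧
    ∀ i k : ℕ, k < 2 * n i →
      u ((∑ j ∈ Finset.range i, 2 * n j) + k) = decide (n i ≤ k)}

end OmegaFormal
open OmegaFormal

namespace OmegaFormal

/-! ### Stuttering and acceptance -/

/-- `κ` is a reindexing of time that starts at `0`, advances by at most one at every step and is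
unbounded. -/
structure IsStutter (κ : ℕ → ℕ) : Prop where
  zero : κ 0 = 0
  step : ∀ i, κ (i + 1) = κ i ∨ κ (i + 1) = κ i + 1
  unbounded : ∀ n, ∃ i, n ≤ κ i

namespace IsStutter

variable {κ : ℕ → ℕ}

lemma monotone (h : IsStutter κ) : Monotone κ :=
  monotone_nat_of_le_succ fun i => by rcases h.step i with h | h <;> omega

lemma le_self (h : IsStutter κ) (i : ℕ) : κ i ≤ i := by
  induction i with
  | zero => simp [h.zero]
  | succ i ih => rcases h.step i with h | h <;> omega

lemma exists_jump (h : IsStutter κ) (k : ℕ) : ∃ i, κ i = k ∧ κ (i + 1) = k + 1 := by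
  classical
  have hex := h.unbounded (k + 1)
  obtain ⟨i, hi⟩ : ∃ i, Nat.find hex = i + 1 := by
    refine Nat.exists_eq_succ_of_ne_zero fun h0 => ?_
    have := Nat.find_spec hex
    rw [h0, h.zero] at this
    omega
  have h1 := Nat.find_spec hex
  have h2 := Nat.find_min hex (m := i) (by omega)
  rw [hi] at h1
  exact ⟨i, by rcases h.step i with h | h <;> omega, by rcases h.step i with h | h <;> omega⟩

lemma tendsto (h : IsStutter κ) : Filter.Tendsto κ Filter.atTop Filter.atTop :=
  Filter.tendsto_atTop_atTop_of_monotone h.monotone h.unbounded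

lemma comp {κ' : ℕ → ℕ} (h : IsStutter κ) (h' : IsStutter κ') : IsStutter (κ ∘ κ') where
  zero := by simp [h.zero, h'.zero]
  step i := by
    rcases h'.step i with e | e
    · simp [e]
    · simpa [e] using h.step (κ' i)
  unbounded n := by
    obtain ⟨i, hi⟩ := h.unbounded n
    obtain ⟨l, hl⟩ := h'.unbounded i
    exact ⟨l, hi.trans (h.monotone hl)⟩

lemma sigmaSet_comp {Q : Type*} (h : IsStutter κ) (σ : AccSigma) (f : ℕ → Q) :
    sigmaSet σ (f ∘ κ) = sigmaSet σ f := by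
  have hsurj : Function.Surjective κ := fun k => (h.exists_jump k).imp fun _ hi => hi.1
  cases σ with
  | ran => exact hsurj.range_comp f
  | inf =>
    ext q
    constructor
    · intro hq n
      obtain ⟨N, hN⟩ := h.unbounded n
      obtain ⟨i, hi, e⟩ := hq N
      exact ⟨κ i, hN.trans (h.monotone hi), e⟩
    · intro hq n
      obtain ⟨k, hk, e⟩ := hq n
      obtain ⟨i, rfl⟩ := hsurj k
      exact ⟨i, hk.trans (h.le_self i), e⟩

lemma isAccepting_comp {Q : Type*} (h : IsStutter κ) (σ : AccSigma) (ρ : AccRho)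
    (𝓕 : Set (Set Q)) (f : ℕ → Q) : IsAccepting σ ρ 𝓕 (f ∘ κ) ↔ IsAccepting σ ρ 𝓕 f := by
  simp only [IsAccepting, h.sigmaSet_comp]

end IsStutter

lemma sigmaSet_comp_left {Q Q' : Type*} [Finite Q'] (π : Q' → Q) (σ : AccSigma) (f : ℕ → Q') :
    sigmaSet σ (π ∘ f) = π '' sigmaSet σ f := by
  cases σ with
  | ran => exact Set.range_comp π f
  | inf =>
    ext q
    constructor
    · intro hq
      by_contra hcon
      have hfin : ∀ a : Q', ∃ n, π a = q → ∀ i, n ≤ i → f i ≠ a := by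
        intro a
        by_contra! ha
        exact hcon ⟨a, fun n => (ha n).2, (ha 0).1⟩
      choose N hN using hfin
      obtain ⟨B, hB⟩ := (Set.finite_range N).bddAbove
      obtain ⟨i, hi, e⟩ := hq B
      exact hN (f i) e i ((hB ⟨f i, rfl⟩).trans hi) rfl
    · rintro ⟨a, ha, rfl⟩ n
      obtain ⟨i, hi, e⟩ := ha n
      exact ⟨i, hi, congrArg π e⟩

/-- Pulling the designated sets back along a surjection of finite state sets preserves acceptance
in all modes. -/
lemma isAccepting_lift {Q Q' : Type*} [Finite Q'] {π : Q' → Q} (hπ : Function.Surjective π)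
    (σ : AccSigma) (ρ : AccRho) (𝓕 : Set (Set Q)) (f : ℕ → Q') :
    IsAccepting σ ρ {F | π '' F ∈ 𝓕} f ↔ IsAccepting σ ρ 𝓕 (π ∘ f) := by
  simp only [IsAccepting, sigmaSet_comp_left]
  constructor
  · rintro ⟨F, hF, h⟩
    refine ⟨_, hF, ?_⟩
    cases ρ with
    | cap => exact (h.image π).mono (Set.image_inter_subset π _ _)
    | sub => exact Set.image_mono h
    | eq => exact congrArg (π '' ·) h
  · rintro ⟨F, hF, h⟩
    cases ρ with
    | cap =>
      refine ⟨π ⁻¹' F, by simpa [Set.image_preimage_eq F hπ] using hF, ?_⟩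
      obtain ⟨_, ⟨a, ha, rfl⟩, hb⟩ := h
      exact ⟨a, ha, hb⟩
    | sub =>
      exact ⟨π ⁻¹' F, by simpa [Set.image_preimage_eq F hπ] using hF, Set.image_subset_iff.1 h⟩
    | eq => exact ⟨_, by rw [Set.mem_ofPred_eq, show _ = F from h]; exact hF, rfl⟩

/-! ### Transferring infinite runs along stuttering simulations -/

lemma exists_seq_of_forall_exists {α : Type*} {r : ℕ → α → α → Prop} (p : ℕ → α → Prop) {a : α}
    (ha : p 0 a) (h : ∀ i a, p i a → ∃ b, r i a b ∧ p (i + 1) b) :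
    ∃ s : ℕ → α, s 0 = a ∧ ∀ i, p i (s i) ∧ r i (s i) (s (i + 1)) := by
  choose! g hg using h
  let s : ℕ → α := fun n => Nat.rec a (fun i b => g i b) n
  have hs : ∀ i, p i (s i) := by
    intro i
    induction i with
    | zero => exact ha
    | succ i ih => exact (hg i _ ih).2
  exact ⟨s, rfl, fun i => ⟨hs i, (hg i _ (hs i)).1⟩⟩

/-- A run `x` all of whose steps either keep a simulated configuration (and satisfy `D`) or
advance it (by `H`) induces a simulated run, provided it cannot stutter forever. -/
lemma exists_simulated_run {C C' : Type*} (x : ℕ → C) (R : C → C' → Prop)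
    (D : C → C → Prop) (H : C → C' → C' → Prop) {y₀ : C'} (h₀ : R (x 0) y₀)
    (hstep : ∀ i y, R (x i) y → (R (x (i + 1)) y ∧ D (x i) (x (i + 1))) ∨
      ∃ y', H (x i) y y' ∧ R (x (i + 1)) y')
    (hfair : ∀ i₀ y, ¬ ∀ i, i₀ ≤ i → R (x i) y ∧ D (x i) (x (i + 1))) :
    ∃ (z : ℕ → C') (κ : ℕ → ℕ), z 0 = y₀ ∧ IsStutter κ ∧ (∀ i, R (x i) (z (κ i))) ∧
      ∀ k, ∃ i, k ≤ i ∧ H (x i) (z k) (z (k + 1)) := by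
  obtain ⟨s, hs0, hs⟩ := exists_seq_of_forall_exists
    (r := fun i (a b : C' × ℕ) => (b = a ∧ D (x i) (x (i + 1))) ∨
      (b.2 = a.2 + 1 ∧ H (x i) a.1 b.1)) (fun i a => R (x i) a.1) (a := (y₀, 0)) h₀ (by
    rintro i ⟨y, n⟩ hy
    rcases hstep i y hy with ⟨h, hD⟩ | ⟨y', h, h'⟩
    · exact ⟨(y, n), Or.inl ⟨rfl, hD⟩, h⟩
    · exact ⟨(y', n + 1), Or.inr ⟨rfl, h⟩, h'⟩)
  let κ : ℕ → ℕ := fun i => (s i).2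
  have hmono : Monotone κ := monotone_nat_of_le_succ fun i => by
    rcases (hs i).2 with h | h
    · exact (congrArg Prod.snd h.1).ge
    · exact (Nat.le_succ _).trans h.1.ge
  have hκ : IsStutter κ := by
    refine ⟨by simp [κ, hs0], fun i => (hs i).2.imp (fun h => congrArg Prod.snd h.1) And.left, ?_⟩
    by_contra! hbdd
    obtain ⟨B, hB⟩ := hbdd
    have hex : ∃ k, ∀ i, κ i ≤ k := ⟨B, fun i => (hB i).le⟩
    classical
    obtain ⟨i₀, hi₀⟩ : ∃ i₀, κ i₀ = Nat.find hex := by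
      by_contra! hne
      have hlt : ∀ i, κ i < Nat.find hex := fun i =>
        lt_of_le_of_ne (Nat.find_spec hex i) (hne i)
      have h1 := hlt 0
      exact Nat.find_min hex (m := Nat.find hex - 1) (by omega) fun i => by
        have := hlt i
        omega
    have hst : ∀ i, i₀ ≤ i → s (i + 1) = s i ∧ D (x i) (x (i + 1)) := fun i hi => by
      rcases (hs i).2 with h | h
      · exact h
      · have h1 := Nat.find_spec hex (i + 1)
        have h2 := hmono hi
        have h3 : κ (i + 1) = κ i + 1 := h.1
        omega
    have hconst : ∀ i, i₀ ≤ i → s i = s i₀ := fun i hi => by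
      induction i, hi using Nat.le_induction with
      | base => rfl
      | succ i hi ih => rw [(hst i hi).1, ih]
    exact hfair i₀ (s i₀).1 fun i hi => ⟨hconst i hi ▸ (hs i).1, (hst i hi).2⟩
  have heq : ∀ i d, κ (i + d) = κ i → s (i + d) = s i := fun i d => by
    induction d with
    | zero => exact fun _ => rfl
    | succ d ih =>
      intro h
      have h1 := hmono (Nat.le_add_right i d)
      have h2 := hmono (Nat.le_succ (i + d))
      rcases (hs (i + d)).2 with h' | h'
      · exact h'.1.trans (ih (by simp only [Nat.add_assoc, Nat.succ_eq_add_one] at *; omega))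
      · have h3 : κ (i + d + 1) = κ (i + d) + 1 := h'.1
        simp only [Nat.add_assoc, Nat.succ_eq_add_one] at *
        omega
  have heq' : ∀ i i', κ i = κ i' → s i = s i' := fun i i' h => by
    rcases le_total i i' with hle | hle <;> obtain ⟨d, rfl⟩ := Nat.exists_eq_add_of_le hle
    · exact (heq i d h.symm).symm
    · exact heq i' d h
  choose t ht ht' using hκ.exists_jump
  refine ⟨fun k => (s (t k)).1, κ, ?_, hκ, fun i => ?_, fun k => ⟨t k, ?_, ?_⟩⟩
  · beta_reduce
    rw [heq' (t 0) 0 (by rw [ht, hκ.zero]), hs0]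
  · beta_reduce
    rw [heq' (t (κ i)) i (ht _)]
    exact (hs i).1
  · exact (ht k).ge.trans (hκ.le_self _)
  · beta_reduce
    rw [heq' (t (k + 1)) (t k + 1) (by rw [ht, ht'])]
    rcases (hs (t k)).2 with h | h
    · have h1 : κ (t k + 1) = κ (t k) := congrArg Prod.snd h.1
      have h2 := ht k
      have h3 := ht' k
      omega
    · exact h.2

/-- Nonempty finite paths leading from stage `k` to stage `k + 1`, for all `k`, concatenate to an
infinite run. -/
lemma exists_concatenated_run {C : Type*} (S : C → C → Prop) (R P : ℕ → C → Prop) {x₀ : C}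
    (h₀ : R 0 x₀)
    (hpath : ∀ k x, R k x →
      ∃ x', R (k + 1) x' ∧ Relation.TransGen (fun a b => P k a ∧ S a b) x x') :
    ∃ (x : ℕ → C) (κ : ℕ → ℕ), x 0 = x₀ ∧ IsStutter κ ∧
      ∀ i, P (κ i) (x i) ∧ S (x i) (x (i + 1)) := by
  let Rem : ℕ → ℕ → C → Prop := fun k n => Nat.rec (motive := fun _ => C → Prop) (R (k + 1))
    (fun _ ih a => ∃ b, (P k a ∧ S a b) ∧ ih b) n
  have hrem : ∀ k x, R k x → ∃ n, Rem k (n + 1) x := fun k x hx => by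
    obtain ⟨x', hx', hp⟩ := hpath k x hx
    clear hx
    induction hp using Relation.TransGen.head_induction_on with
    | single h => exact ⟨0, _, h, hx'⟩
    | head h _ ih =>
      obtain ⟨n, hn⟩ := ih
      exact ⟨n + 1, _, h, hn⟩
  obtain ⟨n₀, hn₀⟩ := hrem 0 x₀ h₀
  obtain ⟨s, hs0, hs⟩ := exists_seq_of_forall_exists
    (r := fun _ (a b : ℕ × ℕ × C) => (P a.1 a.2.2 ∧ S a.2.2 b.2.2) ∧
      ((b.1 = a.1 ∧ b.2.1 < a.2.1) ∨ b.1 = a.1 + 1))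
    (fun _ a => Rem a.1 (a.2.1 + 1) a.2.2) (a := (0, n₀, x₀)) hn₀ (by
    rintro - ⟨k, n, x⟩ ⟨b, hb, hr⟩
    cases n with
    | zero =>
      obtain ⟨n, hn⟩ := hrem (k + 1) b hr
      exact ⟨(k + 1, n, b), ⟨hb, Or.inr rfl⟩, hn⟩
    | succ n => exact ⟨(k, n, b), ⟨hb, Or.inl ⟨rfl, Nat.lt_succ_self n⟩⟩, hr⟩)
  refine ⟨fun i => (s i).2.2, fun i => (s i).1, by simp [hs0], ⟨by simp [hs0], fun i => ?_, ?_⟩,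
    fun i => (hs i).2.1⟩
  · exact (hs i).2.2.imp And.left id
  · have key : ∀ n i, (s i).2.1 ≤ n → ∃ i', (s i').1 = (s i).1 + 1 := fun n => by
      induction n with
      | zero =>
        intro i hi
        rcases (hs i).2.2 with h | h
        · omega
        · exact ⟨i + 1, h⟩
      | succ n ih =>
        intro i hi
        rcases (hs i).2.2 with h | h
        · obtain ⟨i', hi'⟩ := ih (i + 1) (by omega)
          exact ⟨i', by omega⟩
        · exact ⟨i + 1, h⟩
    intro n
    induction n with
    | zero => exact ⟨0, Nat.zero_le _⟩
    | succ n ih =>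
      obtain ⟨i, hi⟩ := ih
      obtain ⟨i', hi'⟩ := key _ i le_rfl
      exact ⟨i', by omega⟩

/-! ### Asynchronous multi-tape machines

In every step of an asynchronous machine a single tape is read, rewritten and moved. -/

/-- Configurations of a machine with tapes indexed by `J`. -/
structure TapesConf (Q Γ J : Type) where
  st : Q
  tape : J → ℕ → Γ
  pos : J → ℕ

/-- A step of an asynchronous machine operating on tape `j`. -/
def AsyncStep {Q Γ J : Type} [DecidableEq J] (tr : Q → J → Γ → Q → Γ → Move → Prop) (j : J)
    (c c' : TapesConf Q Γ J) : Prop :=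
  ∃ a d, tr c.st j (c.tape j (c.pos j)) c'.st a d ∧
    c'.tape = Function.update c.tape j (Function.update (c.tape j) (c.pos j) a) ∧
    c'.pos = Function.update c.pos j (moveHead d (c.pos j))

/-! ### The single-tape simulation

The cells of the simulating tape carry one symbol for each simulated tape. The simulating head works
between a left boundary `b` and a right boundary `b + ℓ`. Cell `n` of the distinguished tape `j₀` is
stored at position `n`, cell `n` of any other tape at position `b + n`. The left boundary may be
advanced as long as the simulated head of tape `j₀` is to the right of it, shifting the contents of
all other tapes to the right. -/

/-- Marks on the simulating tape: simulated heads, the two boundaries, and the origin. -/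
inductive Mark (J : Type)
  | head (j : J)
  | left
  | right
  | origin

instance {J : Type} [Finite J] : Finite (Mark J) :=
  Finite.of_injective (β := Option (Option (Option J)))
    (fun
      | .head j => some (some (some j))
      | .left => some (some none)
      | .right => some none
      | .origin => none)
    (by rintro (_ | _ | _ | _) (_ | _ | _ | _) h <;> simp_all)

/-- The mark moves along when the left boundary is advanced. -/
def Mark.Moving {J : Type} (j₀ : J) : Mark J → Prop
  | .head j => j ≠ j₀
  | .left => True
  | .right => True
  | .origin => False

/-- Cells of the simulating tape. -/
structure Cell (Γ J : Type) where
  sym : J → Γ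
  marks : Set (Mark J)

instance {Γ J : Type} [Finite Γ] [Finite J] : Finite (Cell Γ J) :=
  Finite.of_injective (fun c : Cell Γ J => (c.sym, c.marks)) (by
    rintro ⟨_, _⟩ ⟨_, _⟩ h
    simp_all)

/-- States of the simulating machine: moving around between the boundaries, placing the marks
`E`, or shifting tape contents, with `c` the original content of the cell to the left. -/
inductive SimState (Q Γ J : Type)
  | seek (s : Q)
  | place (s : Q) (E : Set (Mark J))
  | shift (s : Q) (c : Cell Γ J)

/-- The simulated state. -/
def SimState.st {Q Γ J : Type} : SimState Q Γ J → Q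
  | .seek s => s
  | .place s _ => s
  | .shift s _ => s

instance {Q Γ J : Type} [Finite Q] [Finite Γ] [Finite J] : Finite (SimState Q Γ J) :=
  Finite.of_injective (β := Q × (Option (Set (Mark J) ⊕ Cell Γ J)))
    (fun
      | .seek s => (s, none)
      | .place s E => (s, some (.inl E))
      | .shift s c => (s, some (.inr c)))
    (by rintro (_ | _ | _) (_ | _ | _) h <;> simp_all)

section Simulation

variable {Q Γ J : Type}

/-- Add marks to a cell. -/
def Cell.overlay (E : Set (Mark J)) (c : Cell Γ J) : Cell Γ J := ⟨c.sym, E ∪ c.marks⟩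

lemma Cell.sym_update_overlay (T : ℕ → Cell Γ J) (p k : ℕ) (E : Set (Mark J)) :
    (Function.update T p ((T p).overlay E) k).sym = (T k).sym := by
  by_cases h : k = p
  · subst h
    simp [Cell.overlay]
  · simp [h]

variable [DecidableEq J]

/-- The cell obtained from `c` when the moving content of its left neighbour `c'` is shifted in. -/
def Cell.shiftIn (j₀ : J) (c' c : Cell Γ J) : Cell Γ J where
  sym j := if j = j₀ then c.sym j else c'.sym j
  marks := {μ | (μ.Moving j₀ ∧ μ ∈ c'.marks) ∨ (¬ μ.Moving j₀ ∧ μ ∈ c.marks)}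

/-- The marks which the simulating head carries along when the head of tape `j` is moved by `d`. -/
def Cell.carried (c : Cell Γ J) (j : J) (d : Move) : Set (Mark J) :=
  {μ | μ = .head j ∨ (μ = .right ∧ d = .R ∧ .right ∈ c.marks)}

/-- `PhysMove j₀ j c d d'`: moving the head of tape `j` by `d`, starting on the cell `c`, is
simulated by the move `d'`. -/
inductive PhysMove (j₀ j : J) (c : Cell Γ J) : Move → Move → Prop
  | stay : PhysMove j₀ j c .S .S
  | right : PhysMove j₀ j c .R .R
  | left : .left ∉ c.marks → PhysMove j₀ j c .L .L
  | bump : (j ≠ j₀ → .left ∈ c.marks) → (j = j₀ → .origin ∈ c.marks) → PhysMove j₀ j c .L .S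

/-- The transition relation of the simulating machine. -/
inductive SimTrans (tr : Q → J → Γ → Q → Γ → Move → Prop) (j₀ : J) :
    SimState Q Γ J → Cell Γ J → SimState Q Γ J → Cell Γ J → Move → Prop
  | left (s c) : .left ∉ c.marks → SimTrans tr j₀ (.seek s) c (.seek s) c .L
  | right (s c) : .right ∉ c.marks → SimTrans tr j₀ (.seek s) c (.seek s) c .R
  | op (s c j s' a d d') : .head j ∈ c.marks → tr s j (c.sym j) s' a d → PhysMove j₀ j c d d' →
      SimTrans tr j₀ (.seek s) c (.place s' (c.carried j d))
        ⟨Function.update c.sym j a, c.marks \ c.carried j d⟩ d'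
  | place (s E c) : SimTrans tr j₀ (.place s E) c (.seek s) (c.overlay E) .S
  | shiftStart (s c) : .left ∈ c.marks → .head j₀ ∉ c.marks →
      SimTrans tr j₀ (.seek s) c (.shift s c) c .R
  | shiftGo (s c' c) : .right ∉ c'.marks →
      SimTrans tr j₀ (.shift s c') c (.shift s c) (c'.shiftIn j₀ c) .R
  | shiftEnd (s c' c) : .right ∈ c'.marks →
      SimTrans tr j₀ (.shift s c') c (.seek s) (c'.shiftIn j₀ c) .S

/-- Configurations of the simulating machine. -/
structure SimConf (Q Γ J : Type) where
  st : SimState Q Γ J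
  tape : ℕ → Cell Γ J
  pos : ℕ

/-- Steps of the simulating machine. -/
def SimStep (tr : Q → J → Γ → Q → Γ → Move → Prop) (j₀ : J) (x x' : SimConf Q Γ J) : Prop :=
  ∃ g d, SimTrans tr j₀ x.st (x.tape x.pos) x'.st g d ∧
    x'.tape = Function.update x.tape x.pos g ∧ x'.pos = moveHead d x.pos

/-- The position at which cell `0` of tape `j` is stored. -/
def offset (j₀ : J) (b : ℕ) (j : J) : ℕ := if j = j₀ then 0 else b

/-- The position of a mark. -/
def Mark.loc (j₀ : J) (b ℓ : ℕ) (y : TapesConf Q Γ J) : Mark J → ℕ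
  | .head j => offset j₀ b j + y.pos j
  | .left => b
  | .right => b + ℓ
  | .origin => 0

/-- The tape `T` with boundaries `b` and `b + ℓ` represents the configuration `y`. -/
structure Represents (j₀ : J) (blank : Γ) (b ℓ : ℕ) (T : ℕ → Cell Γ J) (y : TapesConf Q Γ J) :
    Prop where
  mem_marks : ∀ k, b ≤ k → ∀ μ, μ ∈ (T k).marks ↔ k = μ.loc j₀ b ℓ y
  sym : ∀ j n, b ≤ offset j₀ b j + n → (T (offset j₀ b j + n)).sym j = y.tape j n
  le_pos : b ≤ y.pos j₀
  pos_le : ∀ j, offset j₀ b j + y.pos j ≤ b + ℓ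
  tape_eq_blank : ∀ j, j ≠ j₀ → ∀ n, ℓ < n → y.tape j n = blank

/-- The configuration `x` of the simulating machine represents the configuration `y`. -/
def SimRel (j₀ : J) (blank : Γ) (b : ℕ) (x : SimConf Q Γ J) (y : TapesConf Q Γ J × ℕ) : Prop :=
  x.st.st = y.1.st ∧
  match x.st with
  | .seek _ => Represents j₀ blank b y.2 x.tape y.1 ∧ b ≤ x.pos ∧ x.pos ≤ b + y.2
  | .place _ E =>
    Represents j₀ blank b y.2 (Function.update x.tape x.pos ((x.tape x.pos).overlay E)) y.1 ∧
      b ≤ x.pos ∧ x.pos ≤ b + y.2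
  | .shift _ c => ∃ (T : ℕ → Cell Γ J) (p : ℕ), Represents j₀ blank b y.2 T y.1 ∧
      b < y.1.pos j₀ ∧ x.pos = p + 1 ∧ b ≤ p ∧ p ≤ b + y.2 ∧ c = T p ∧
      (∀ k, p < k → x.tape k = T k) ∧
      ∀ k, b ≤ k → k < p → x.tape (k + 1) = (T k).shiftIn j₀ (T (k + 1))

lemma SimRel.pos_bounds {j₀ : J} {blank : Γ} {b : ℕ} {x : SimConf Q Γ J}
    {y : TapesConf Q Γ J × ℕ} (h : SimRel j₀ blank b x y) :
    b ≤ x.pos ∧ x.pos ≤ y.1.pos j₀ + y.2 + 1 := by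
  obtain ⟨st, T, p⟩ := x
  cases st with
  | seek => have := h.2.1.le_pos; have := h.2.2; dsimp only at *; omega
  | place => have := h.2.1.le_pos; have := h.2.2; dsimp only at *; omega
  | shift =>
    obtain ⟨-, T, p, hT, h⟩ := h
    have := hT.le_pos
    dsimp only at *
    omega

lemma Represents.eq_of_head_mem {j₀ : J} {blank : Γ} {b ℓ : ℕ} {T : ℕ → Cell Γ J}
    {y : TapesConf Q Γ J} (h : Represents j₀ blank b ℓ T y) {p : ℕ} (hp : b ≤ p) {j : J}
    (hj : .head j ∈ (T p).marks) : p = offset j₀ b j + y.pos j :=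
  (h.mem_marks p hp _).1 hj

/-- Operating on a tape preserves representation. -/
lemma Represents.op {j₀ : J} {blank : Γ} {b ℓ : ℕ} {T : ℕ → Cell Γ J}
    {y y' : TapesConf Q Γ J} (h : Represents j₀ blank b ℓ T y) {p : ℕ} (hp : b ≤ p)
    (hp' : p ≤ b + ℓ) {j : J} (hj : .head j ∈ (T p).marks) {a : Γ} {d d' : Move}
    (hd : PhysMove j₀ j (T p) d d')
    (htape : y'.tape = Function.update y.tape j (Function.update (y.tape j) (y.pos j) a))
    (hpos : y'.pos = Function.update y.pos j (moveHead d (y.pos j))) :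
    ∃ ℓ', SimRel j₀ blank b
      ⟨.place y'.st ((T p).carried j d),
        Function.update T p ⟨Function.update (T p).sym j a, (T p).marks \ (T p).carried j d⟩,
        moveHead d' p⟩ (y', ℓ') := by
  classical
  have hpj := h.eq_of_head_mem hp hj
  have hleft := h.mem_marks p hp .left
  have hright := h.mem_marks p hp .right
  have horigin := h.mem_marks p hp .origin
  simp only [Mark.loc] at hleft hright horigin
  have hoff : offset j₀ b j ≤ b := by unfold offset; split_ifs <;> omega
  let ℓ' := if d = .R ∧ .right ∈ (T p).marks then ℓ + 1 else ℓ
  have hℓ : ℓ ≤ ℓ' := by simp only [ℓ']; split_ifs <;> omega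
  have hposj : y'.pos j = moveHead d (y.pos j) := by simp [hpos]
  have hposi : ∀ i, i ≠ j → y'.pos i = y.pos i := fun i hi => by simp [hpos, hi]
  have key : moveHead d' p = offset j₀ b j + y'.pos j ∧ b ≤ moveHead d' p ∧
      moveHead d' p ≤ b + ℓ' := by
    rw [hposj]
    cases hd with
    | stay => simp only [moveHead]; omega
    | right =>
      simp only [moveHead, ℓ', true_and, hright]
      split_ifs <;> omega
    | left hl =>
      rw [hleft] at hl
      simp only [moveHead]
      omega
    | bump h1 h2 =>
      simp only [moveHead]
      by_cases hjj : j = j₀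
      · have := horigin.1 (h2 hjj)
        simp only [offset, hjj, if_true] at *
        omega
      · have := hleft.1 (h1 hjj)
        simp only [offset, hjj, if_false] at *
        omega
  obtain ⟨key, hge, hle⟩ := key
  have hlocE : ∀ μ ∈ (T p).carried j d, μ.loc j₀ b ℓ y = p ∧ μ.loc j₀ b ℓ' y' = moveHead d' p := by
    rintro μ (rfl | ⟨rfl, rfl, hr⟩)
    · exact ⟨hpj.symm, key.symm⟩
    · cases hd
      have := hright.1 hr
      simp only [Mark.loc, ℓ', hr, and_self, if_true, moveHead]
      omega
  have hlocN : ∀ μ, μ ∉ (T p).carried j d → μ.loc j₀ b ℓ' y' = μ.loc j₀ b ℓ y := by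
    intro μ hμ
    simp only [Cell.carried, Set.mem_ofPred_eq, not_or] at hμ
    cases μ with
    | head i => simp only [Mark.loc, hposi i (fun e => hμ.1 (e ▸ rfl))]
    | left => rfl
    | right =>
      have : ¬ (d = .R ∧ .right ∈ (T p).marks) := fun h => hμ.2 ⟨rfl, h⟩
      simp only [Mark.loc, ℓ', this, if_false]
    | origin => rfl
  clear_value ℓ'
  refine ⟨ℓ', rfl, ⟨?_, ?_, ?_, ?_, ?_⟩, hge, hle⟩ <;> dsimp only
  · intro k hk μ
    have hμ := h.mem_marks k hk μ
    by_cases hE : μ ∈ (T p).carried j d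
    · obtain ⟨h1, h2⟩ := hlocE μ hE
      rw [h1] at hμ
      rw [h2]
      simp only [Function.update_apply, Cell.overlay]
      split_ifs <;> simp_all
    · rw [hlocN μ hE, ← hμ]
      simp only [Function.update_apply, Cell.overlay]
      split_ifs <;> simp_all
  · intro i n hn
    have hs := h.sym i n hn
    rw [htape, Cell.sym_update_overlay]
    by_cases hi : i = j
    · subst hi
      have hn' : offset j₀ b i + n = p ↔ n = y.pos i := by omega
      rw [Function.update_self, Function.update_apply (y.tape i), ← hs]
      simp only [Function.update_apply, hn']
      split_ifs <;> simp
    · rw [Function.update_of_ne hi, ← hs, Function.update_apply]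
      split_ifs with hk <;> simp [hk, hi]
  · by_cases hjj : j = j₀
    · subst hjj
      simp only [offset, if_true] at key
      omega
    · rw [hposi _ (Ne.symm hjj)]
      exact h.le_pos
  · intro i
    by_cases hi : i = j
    · subst hi
      omega
    · rw [hposi i hi]
      exact (h.pos_le i).trans (by omega)
  · intro i hi n hn
    have hb := h.tape_eq_blank i hi n (by omega)
    rw [htape]
    by_cases hij : i = j
    · subst hij
      have h1 := h.pos_le i
      have h2 : n ≠ y.pos i := by
        simp only [offset, hi, if_false] at h1
        omega
      simp [h2, hb]
    · simp [hij, hb]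

/-- Advancing the left boundary preserves representation. -/
lemma Represents.shift {j₀ : J} {blank : Γ} {b ℓ : ℕ} {T T' : ℕ → Cell Γ J}
    {y : TapesConf Q Γ J} (h : Represents j₀ blank b ℓ T y) (hb : b < y.pos j₀)
    (hgt : ∀ k, b + ℓ + 1 < k → T' k = T k)
    (hle : ∀ k, b ≤ k → k ≤ b + ℓ → T' (k + 1) = (T k).shiftIn j₀ (T (k + 1))) :
    Represents j₀ blank (b + 1) ℓ T' y := by
  have hpos := h.pos_le
  refine ⟨fun k hk μ => ?_, fun j n hn => ?_, hb, fun j => ?_, h.tape_eq_blank⟩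
  · obtain ⟨k, rfl⟩ : ∃ k', k = k' + 1 := ⟨k - 1, by omega⟩
    have h1 := h.mem_marks k (by omega) μ
    have h2 := h.mem_marks (k + 1) (by omega) μ
    rcases le_or_gt k (b + ℓ) with hkl | hkl
    · rw [hle k (by omega) hkl]
      simp only [Cell.shiftIn, Set.mem_ofPred_eq, h1, h2]
      cases μ with
      | head j =>
        by_cases hj : j = j₀
        · subst hj
          simp [Mark.Moving, Mark.loc, offset]
        · simp only [Mark.Moving, Mark.loc, offset, hj, if_false]
          simp only [ne_eq, hj, not_false_eq_true, true_and, not_true_eq_false, false_and, or_false]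
          omega
      | left => simp [Mark.Moving, Mark.loc]
      | right => simp [Mark.Moving, Mark.loc]; omega
      | origin => simp [Mark.Moving, Mark.loc]
    · rw [hgt _ (by omega), h2]
      cases μ with
      | head j =>
        have := hpos j
        simp only [Mark.loc, offset] at *
        split_ifs at * <;> omega
      | left => simp only [Mark.loc]; omega
      | right => simp only [Mark.loc]; omega
      | origin => simp [Mark.loc]
  · by_cases hj : j = j₀
    · have hs := h.sym j n
      simp only [offset, hj, if_true, zero_add] at hs hn ⊢
      rw [← hs (by omega)]
      obtain ⟨n, rfl⟩ : ∃ k', n = k' + 1 := ⟨n - 1, by omega⟩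
      rcases le_or_gt n (b + ℓ) with hkl | hkl
      · rw [hle n (by omega) hkl]
        simp [Cell.shiftIn]
      · rw [hgt _ (by omega)]
    · have hs := h.sym j n
      have hs' := h.sym j (n + 1)
      simp only [offset, hj, if_false] at hs hs' hn ⊢
      rcases le_or_gt n ℓ with hkl | hkl
      · rw [← hs (by omega), add_right_comm, hle _ (by omega) (by omega)]
        simp [Cell.shiftIn, hj]
      · rw [hgt _ (by omega), h.tape_eq_blank j hj n hkl, ← h.tape_eq_blank j hj (n + 1) (by omega),
          ← hs' (by omega), add_assoc, add_comm 1 n]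
  · have := hpos j
    by_cases hj : j = j₀ <;> simp only [offset, hj, if_true, if_false] at * <;> omega

lemma SimRel.shiftGo {j₀ : J} {blank : Γ} {b p : ℕ} {s : Q} {c : Cell Γ J} {T : ℕ → Cell Γ J}
    {y : TapesConf Q Γ J × ℕ} (h : SimRel j₀ blank b ⟨.shift s c, T, p⟩ y)
    (hc : .right ∉ c.marks) :
    SimRel j₀ blank b
      ⟨.shift s (T p), Function.update T p (c.shiftIn j₀ (T p)), p + 1⟩ y := by
  obtain ⟨hst, U, p', hU, hb, hp, hbp, hpl, rfl, hgt, hlt⟩ := h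
  dsimp only at hp hgt hlt
  subst hp
  rw [hU.mem_marks p' hbp] at hc
  refine ⟨hst, U, p' + 1, hU, hb, rfl, by omega, ?_, hgt _ (by omega), fun k hk => ?_,
    fun k hk hk' => ?_⟩
  · simp only [Mark.loc] at hc
    omega
  · dsimp only
    rw [Function.update_of_ne (by omega), hgt k (by omega)]
  · dsimp only
    rcases Nat.lt_succ_iff_lt_or_eq.1 hk' with hk' | rfl
    · rw [Function.update_of_ne (by omega), hlt k hk hk']
    · rw [Function.update_self, hgt _ (by omega)]

lemma SimRel.shiftEnd {j₀ : J} {blank : Γ} {b p : ℕ} {s : Q} {c : Cell Γ J} {T : ℕ → Cell Γ J}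
    {y : TapesConf Q Γ J × ℕ} (h : SimRel j₀ blank b ⟨.shift s c, T, p⟩ y)
    (hc : .right ∈ c.marks) :
    SimRel j₀ blank (b + 1) ⟨.seek s, Function.update T p (c.shiftIn j₀ (T p)), p⟩ y := by
  obtain ⟨hst, U, p', hU, hb, hp, hbp, hpl, rfl, hgt, hlt⟩ := h
  dsimp only at hp hgt hlt
  subst hp
  rw [hU.mem_marks p' hbp] at hc
  simp only [Mark.loc] at hc
  refine ⟨hst, hU.shift hb (fun k hk => ?_) fun k hk hk' => ?_, by dsimp only; omega,
    by dsimp only; omega⟩ <;> dsimp only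
  · rw [Function.update_of_ne (by omega), hgt k (by omega)]
  · rcases (hc ▸ hk').lt_or_eq with hk' | rfl
    · rw [Function.update_of_ne (by omega), hlt k hk hk']
    · rw [Function.update_self, hgt _ (by omega)]

lemma SimRel.shiftStart {j₀ : J} {blank : Γ} {b p : ℕ} {s : Q} {T : ℕ → Cell Γ J}
    {y : TapesConf Q Γ J × ℕ} (h : SimRel j₀ blank b ⟨.seek s, T, p⟩ y)
    (hl : .left ∈ (T p).marks) (hj : .head j₀ ∉ (T p).marks) :
    SimRel j₀ blank b ⟨.shift s (T p), T, p + 1⟩ y := by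
  obtain ⟨hst, hT, hp, hp'⟩ := h
  dsimp only at hT hp hp'
  rw [hT.mem_marks p hp] at hl hj
  simp only [Mark.loc, offset, if_true, zero_add] at hl hj
  have := hT.le_pos
  exact ⟨hst, T, p, hT, by omega, rfl, hp, hp', rfl, fun _ _ => rfl, fun _ _ _ => by omega⟩

/-- Every step of the simulating machine keeps the simulated configuration or advances it. -/
lemma SimRel.step {tr : Q → J → Γ → Q → Γ → Move → Prop} {j₀ : J} {blank : Γ} {b : ℕ}
    {x x' : SimConf Q Γ J} {y : TapesConf Q Γ J × ℕ} (h : SimRel j₀ blank b x y)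
    (hx : SimStep tr j₀ x x') :
    (∃ b', SimRel j₀ blank b' x' y) ∨ ∃ y' : TapesConf Q Γ J × ℕ,
      (∃ j, AsyncStep tr j y.1 y'.1 ∧ (j = j₀ → x.pos = y.1.pos j₀)) ∧
        ∃ b', SimRel j₀ blank b' x' y' := by
  obtain ⟨st, T, p⟩ := x
  obtain ⟨st', T', p'⟩ := x'
  obtain ⟨g, d, ht, hT, hp⟩ := hx
  dsimp only at ht hT hp
  subst hT hp
  cases ht with
  | left s c hl =>
    obtain ⟨hst, hT, hp, hp'⟩ := h
    dsimp only at hT hp hp'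
    rw [hT.mem_marks p hp] at hl
    simp only [Mark.loc] at hl
    refine Or.inl ⟨b, hst, ?_⟩
    simp only [moveHead, Function.update_eq_self]
    exact ⟨hT, by omega, by omega⟩
  | right s c hr =>
    obtain ⟨hst, hT, hp, hp'⟩ := h
    dsimp only at hT hp hp'
    rw [hT.mem_marks p hp] at hr
    simp only [Mark.loc] at hr
    refine Or.inl ⟨b, hst, ?_⟩
    simp only [moveHead, Function.update_eq_self]
    exact ⟨hT, by omega, by omega⟩
  | op s c j s' a d d' hj htr hd =>
    obtain ⟨hst, hT, hp, hp'⟩ := h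
    dsimp only at hT hp hp'
    have hpj := hT.eq_of_head_mem hp hj
    let y' : TapesConf Q Γ J := ⟨s',
      Function.update y.1.tape j (Function.update (y.1.tape j) (y.1.pos j) a),
      Function.update y.1.pos j (moveHead d (y.1.pos j))⟩
    obtain ⟨ℓ', hr⟩ := hT.op (y' := y') hp hp' hj hd rfl rfl
    refine Or.inr ⟨(y', ℓ'), ⟨j, ⟨a, d, ?_, rfl, rfl⟩, ?_⟩, b, hr⟩
    · rw [← hT.sym j _ (hpj ▸ hp), ← hpj, ← hst]
      exact htr
    · rintro rfl
      simpa [offset] using hpj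
  | place s E c => exact Or.inl ⟨b, h⟩
  | shiftStart s c hl hj =>
    refine Or.inl ⟨b, ?_⟩
    simp only [moveHead, Function.update_eq_self]
    exact h.shiftStart hl hj
  | shiftGo s c' c hc => exact Or.inl ⟨b, h.shiftGo hc⟩
  | shiftEnd s c' c hc => exact Or.inl ⟨b + 1, h.shiftEnd hc⟩

/-- A step of the simulating machine from a configuration with simulated state `s` and head position
at least `β`. -/
def GuardedStep (tr : Q → J → Γ → Q → Γ → Move → Prop) (j₀ : J) (s : Q) (β : ℕ)
    (x x' : SimConf Q Γ J) : Prop :=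
  (x.st.st = s ∧ β ≤ x.pos) ∧ SimStep tr j₀ x x'

section Paths

variable {tr : Q → J → Γ → Q → Γ → Move → Prop} {j₀ : J} {blank : Γ} {b ℓ β : ℕ}
  {y : TapesConf Q Γ J}

lemma Represents.seek_right {T : ℕ → Cell Γ J} (h : Represents j₀ blank b ℓ T y) (hβ : β ≤ b)
    (s : Q) {p : ℕ} (hp : b ≤ p) (n : ℕ) (hn : p + n ≤ b + ℓ) :
    Relation.ReflTransGen (GuardedStep tr j₀ s β) ⟨.seek s, T, p⟩ ⟨.seek s, T, p + n⟩ := by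
  induction n with
  | zero => exact .refl
  | succ n ih =>
    refine (ih (by omega)).tail ⟨⟨rfl, by dsimp only; omega⟩, _, _, .right _ _ ?_,
      (Function.update_eq_self _ _).symm, rfl⟩
    rw [h.mem_marks _ (by dsimp only; omega)]
    simp only [Mark.loc]
    omega

lemma Represents.seek_left {T : ℕ → Cell Γ J} (h : Represents j₀ blank b ℓ T y) (hβ : β ≤ b)
    (s : Q) {p : ℕ} (hp : b ≤ p) (n : ℕ) :
    Relation.ReflTransGen (GuardedStep tr j₀ s β) ⟨.seek s, T, p + n⟩ ⟨.seek s, T, p⟩ := by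
  induction n with
  | zero => exact .refl
  | succ n ih =>
    have hl : .left ∉ (T (p + (n + 1))).marks := by
      rw [h.mem_marks _ (by omega)]
      simp only [Mark.loc]
      omega
    have step : GuardedStep tr j₀ s β ⟨.seek s, T, p + (n + 1)⟩ ⟨.seek s, T, p + n⟩ :=
      ⟨⟨rfl, by dsimp only; omega⟩, _, _, .left _ _ hl, (Function.update_eq_self _ _).symm, rfl⟩
    exact ih.head step

lemma Represents.seek {T : ℕ → Cell Γ J} (h : Represents j₀ blank b ℓ T y) (hβ : β ≤ b)
    (s : Q) {p q : ℕ} (hp : b ≤ p) (hq : b ≤ q) (hq' : q ≤ b + ℓ) :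
    Relation.ReflTransGen (GuardedStep tr j₀ s β) ⟨.seek s, T, p⟩ ⟨.seek s, T, q⟩ := by
  rcases le_total p q with hle | hle <;> obtain ⟨n, rfl⟩ := Nat.exists_eq_add_of_le hle
  · exact h.seek_right hβ s hp n hq'
  · exact h.seek_left hβ s hq n

lemma SimRel.shift_path {s : Q} (hβ : β ≤ b) (n : ℕ) : ∀ {c : Cell Γ J} {T : ℕ → Cell Γ J} {p : ℕ},
    SimRel j₀ blank b ⟨.shift s c, T, p⟩ (y, ℓ) → p + n = b + ℓ + 1 →
    ∃ T' p', SimRel j₀ blank (b + 1) ⟨.seek s, T', p'⟩ (y, ℓ) ∧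
      Relation.ReflTransGen (GuardedStep tr j₀ s β) ⟨.shift s c, T, p⟩ ⟨.seek s, T', p'⟩ := by
  induction n with
  | zero =>
    intro c T p h hp
    have hc : .right ∈ c.marks := by
      obtain ⟨-, U, p', hU, -, hp', hbp, -, rfl, -⟩ := h
      rw [hU.mem_marks _ hbp]
      simp only [Mark.loc]
      dsimp only at hp'
      omega
    exact ⟨_, _, h.shiftEnd hc, .single ⟨⟨rfl, hβ.trans h.pos_bounds.1⟩, _, _,
      .shiftEnd _ _ _ hc, rfl, rfl⟩⟩
  | succ n ih =>
    intro c T p h hp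
    have hc : .right ∉ c.marks := by
      obtain ⟨-, U, p', hU, -, hp', hbp, -, rfl, -⟩ := h
      rw [hU.mem_marks _ hbp]
      simp only [Mark.loc]
      dsimp only at hp'
      omega
    obtain ⟨T', p', h', path⟩ := ih (h.shiftGo hc) (by omega)
    exact ⟨T', p', h', path.head ⟨⟨rfl, hβ.trans h.pos_bounds.1⟩, _, _,
      .shiftGo _ _ _ hc, rfl, rfl⟩⟩

lemma SimRel.advance {s : Q} (hβ : β ≤ b) {T : ℕ → Cell Γ J} {p : ℕ}
    (h : SimRel j₀ blank b ⟨.seek s, T, p⟩ (y, ℓ)) (hb : b < y.pos j₀) :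
    ∃ T' p', SimRel j₀ blank (b + 1) ⟨.seek s, T', p'⟩ (y, ℓ) ∧
      Relation.ReflTransGen (GuardedStep tr j₀ s β) ⟨.seek s, T, p⟩ ⟨.seek s, T', p'⟩ := by
  obtain ⟨hst, hT, hp, hp'⟩ := h
  dsimp only at hT hp hp'
  have hl : .left ∈ (T b).marks := (hT.mem_marks b le_rfl _).2 rfl
  have hj : .head j₀ ∉ (T b).marks := by
    rw [hT.mem_marks b le_rfl]
    simp only [Mark.loc, offset, if_true]
    omega
  have hstart : SimRel j₀ blank b ⟨.shift s (T b), T, b + 1⟩ (y, ℓ) :=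
    SimRel.shiftStart ⟨hst, hT, le_rfl, Nat.le_add_right _ _⟩ hl hj
  obtain ⟨T', p', h', path⟩ := hstart.shift_path (tr := tr) hβ ℓ (by omega)
  have step : GuardedStep tr j₀ s β ⟨.seek s, T, b⟩ ⟨.shift s (T b), T, b + 1⟩ :=
    ⟨⟨rfl, hβ⟩, _, _, .shiftStart _ _ hl hj, (Function.update_eq_self _ _).symm, rfl⟩
  exact ⟨T', p', h', (hT.seek hβ s hp le_rfl (Nat.le_add_right _ _)).trans (path.head step)⟩

lemma SimRel.advance_to {s : Q} (hβ : β ≤ b) {T : ℕ → Cell Γ J} {p : ℕ}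
    (h : SimRel j₀ blank b ⟨.seek s, T, p⟩ (y, ℓ)) (n : ℕ) (hn : b + n ≤ y.pos j₀) :
    ∃ T' p', SimRel j₀ blank (b + n) ⟨.seek s, T', p'⟩ (y, ℓ) ∧
      Relation.ReflTransGen (GuardedStep tr j₀ s β) ⟨.seek s, T, p⟩ ⟨.seek s, T', p'⟩ := by
  induction n with
  | zero => exact ⟨T, p, h, .refl⟩
  | succ n ih =>
    obtain ⟨T', p', h', path⟩ := ih (by omega)
    obtain ⟨T'', p'', h'', path'⟩ := h'.advance (tr := tr) (by omega : β ≤ b + n) (by omega)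
    exact ⟨T'', p'', h'', path.trans path'⟩

/-- An operation on tape `j` can be simulated unless it moves the head of tape `j₀` beyond the left
boundary. -/
lemma SimRel.exists_op {s : Q} {j : J} {y' : TapesConf Q Γ J} (hβ : β ≤ b) {T : ℕ → Cell Γ J}
    {p : ℕ} (h : SimRel j₀ blank b ⟨.seek s, T, p⟩ (y, ℓ)) (hy : AsyncStep tr j y y')
    (hb : b ≤ y'.pos j₀) :
    ∃ E T' p' ℓ', SimRel j₀ blank b ⟨.place y'.st E, T', p'⟩ (y', ℓ') ∧
      Relation.TransGen (GuardedStep tr j₀ s β) ⟨.seek s, T, p⟩ ⟨.place y'.st E, T', p'⟩ := by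
  obtain ⟨hst, hT, hp, hp'⟩ := h
  dsimp only at hT hp hp'
  obtain ⟨a, d, htr, htape, hpos⟩ := hy
  obtain ⟨q, hq⟩ : ∃ q, q = offset j₀ b j + y.pos j := ⟨_, rfl⟩
  have hle := hT.le_pos
  have hbq : b ≤ q := by
    rw [hq]
    unfold offset
    split_ifs with hj
    · subst hj
      omega
    · omega
  have hql := hT.pos_le j
  have hhead : .head j ∈ (T q).marks := (hT.mem_marks q hbq _).2 hq
  have hphys : ∃ d', PhysMove j₀ j (T q) d d' := by
    cases d with
    | S => exact ⟨_, .stay⟩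
    | R => exact ⟨_, .right⟩
    | L =>
      by_cases hl : .left ∈ (T q).marks
      · refine ⟨_, .bump (fun _ => hl) fun hj => ?_⟩
        rw [hT.mem_marks q hbq] at hl ⊢
        subst hj
        simp only [Mark.loc, offset, if_true, hpos, Function.update_self, moveHead] at *
        omega
      · exact ⟨_, .left hl⟩
  obtain ⟨d', hd⟩ := hphys
  obtain ⟨ℓ', h'⟩ := hT.op (y' := y') hbq (hq ▸ hql) hhead hd htape hpos
  refine ⟨_, _, _, ℓ', h', Relation.TransGen.tail' (hT.seek hβ s hp hbq (hq ▸ hql))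
    ⟨⟨rfl, hβ.trans hbq⟩, _, _, .op _ _ _ _ _ _ _ hhead ?_ hd, rfl, rfl⟩⟩
  have hs := hT.sym j (y.pos j) (hq ▸ hbq)
  rw [← hq] at hs
  rw [show s = y.st from hst, hs]
  exact htr

lemma SimRel.exists_path {s : Q} {E : Set (Mark J)} {j : J} {y' : TapesConf Q Γ J}
    {T : ℕ → Cell Γ J} {p b' : ℕ} (h : SimRel j₀ blank b ⟨.place s E, T, p⟩ (y, ℓ))
    (hy : AsyncStep tr j y y') (hbb : b ≤ b') (hb : b' ≤ y.pos j₀) (hb' : b' ≤ y'.pos j₀) :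
    ∃ E' T' p' ℓ', SimRel j₀ blank b' ⟨.place y'.st E', T', p'⟩ (y', ℓ') ∧
      Relation.TransGen (GuardedStep tr j₀ s b) ⟨.place s E, T, p⟩ ⟨.place y'.st E', T', p'⟩ := by
  have h₁ : SimRel j₀ blank b ⟨.seek s, Function.update T p ((T p).overlay E), p⟩ (y, ℓ) := h
  obtain ⟨n, rfl⟩ := Nat.exists_eq_add_of_le hbb
  obtain ⟨T₂, p₂, h₂, path₂⟩ := h₁.advance_to (tr := tr) le_rfl n hb
  obtain ⟨E', T', p', ℓ', h', path'⟩ := h₂.exists_op (by omega : b ≤ b + n) hy hb'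
  exact ⟨E', T', p', ℓ', h', Relation.TransGen.head ⟨⟨rfl, h.pos_bounds.1⟩, _, _,
    .place _ _ _, rfl, rfl⟩ (Relation.TransGen.trans_right path₂ path')⟩

end Paths

/-- The initial configuration of the simulating machine, which places all marks at the origin. -/
lemma SimRel.init {j₀ : J} {blank : Γ} {T : ℕ → Cell Γ J} {y : TapesConf Q Γ J}
    (hsym : ∀ j n, (T n).sym j = y.tape j n) (hmarks : ∀ n, (T n).marks = ∅)
    (hpos : ∀ j, y.pos j = 0) (hblank : ∀ j, j ≠ j₀ → ∀ n, y.tape j n = blank) :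
    SimRel j₀ blank 0 ⟨.place y.st Set.univ, T, 0⟩ (y, 0) := by
  have hoff : ∀ j, offset j₀ 0 j = 0 := fun j => by simp [offset]
  refine ⟨rfl, ⟨fun k _ μ => ?_, fun j n _ => ?_, Nat.zero_le _, fun j => ?_,
    fun j hj n _ => hblank j hj n⟩, le_rfl, le_rfl⟩
  · have hloc : μ.loc j₀ 0 0 y = 0 := by cases μ <;> simp [Mark.loc, hoff, hpos]
    by_cases hk : k = 0
    · subst hk
      simp [Cell.overlay, hloc]
    · simp [hk, hmarks, hloc]
  · rw [Cell.sym_update_overlay, hoff, zero_add]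
    exact hsym j n
  · simp [hoff, hpos]

/-- A run of the simulating machine whose head tends to infinity simulates an asynchronous run which
operates on any given cell of tape `j₀` only finitely often. -/
theorem exists_async_run {tr : Q → J → Γ → Q → Γ → Move → Prop} {j₀ : J} {blank : Γ}
    {x : ℕ → SimConf Q Γ J} {y₀ : TapesConf Q Γ J} {b ℓ : ℕ}
    (h₀ : SimRel j₀ blank b (x 0) (y₀, ℓ)) (hx : ∀ i, SimStep tr j₀ (x i) (x (i + 1)))
    (hlim : Filter.Tendsto (fun i => (x i).pos) Filter.atTop Filter.atTop) :
    ∃ (y : ℕ → TapesConf Q Γ J) (j : ℕ → J) (κ : ℕ → ℕ), y 0 = y₀ ∧ IsStutter κ ∧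
      (∀ i, (x i).st.st = (y (κ i)).st) ∧ (∀ k, AsyncStep tr (j k) (y k) (y (k + 1))) ∧
      ∀ N, ∃ K, ∀ k, K ≤ k → j k = j₀ → N ≤ (y k).pos j₀ := by
  obtain ⟨z, κ, hz, hκ, hR, hH⟩ := exists_simulated_run x
    (fun x y => ∃ b, SimRel j₀ blank b x y) (fun _ _ => True)
    (fun x y y' => ∃ j, AsyncStep tr j y.1 y'.1 ∧ (j = j₀ → x.pos = y.1.pos j₀))
    (y₀ := (y₀, ℓ)) ⟨b, h₀⟩
    (fun i y ⟨b, h⟩ => (h.step (hx i)).imp (fun h => ⟨h, trivial⟩) id)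
    (fun i₀ y h => by
      obtain ⟨i, hi, hlt⟩ := ((Filter.eventually_ge_atTop i₀).and
        (hlim.eventually_gt_atTop (y.1.pos j₀ + y.2 + 1))).exists
      obtain ⟨⟨b, hb⟩, -⟩ := h i hi
      exact absurd hb.pos_bounds.2 (not_le.2 hlt))
  choose i hi j hj hij using hH
  refine ⟨fun k => (z k).1, j, κ, by simp [hz], hκ, fun i => (hR i).choose_spec.1, hj,
    fun N => ?_⟩
  obtain ⟨K, hK⟩ := Filter.eventually_atTop.1 (hlim.eventually_ge_atTop N)
  exact ⟨K, fun k hk e => hij k e ▸ hK _ (hk.trans (hi k))⟩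

/-- A sequence tending to infinity has a monotone minorant tending to infinity. -/
lemma exists_monotone_minorant {h : ℕ → ℕ} (hlim : Filter.Tendsto h Filter.atTop Filter.atTop) :
    ∃ β : ℕ → ℕ, β 0 = 0 ∧ Monotone β ∧ Filter.Tendsto β Filter.atTop Filter.atTop ∧
      ∀ k, β (k + 1) ≤ h k ∧ β (k + 1) ≤ h (k + 1) := by
  have hle : ∀ k i, k ≤ i → sInf (h '' Set.Ici k) ≤ h i :=
    fun k i hi => Nat.sInf_le ⟨i, hi, rfl⟩
  have hge : ∀ k n, (∀ i, k ≤ i → n ≤ h i) → n ≤ sInf (h '' Set.Ici k) := fun k n hn =>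
    le_csInf ⟨_, k, Set.mem_Ici.2 le_rfl, rfl⟩ (by rintro _ ⟨i, hi, rfl⟩; exact hn i hi)
  refine ⟨fun k => k.casesOn 0 fun k => sInf (h '' Set.Ici k), rfl, monotone_nat_of_le_succ ?_, ?_,
    fun k => ⟨hle k k le_rfl, hle k (k + 1) (Nat.le_succ k)⟩⟩
  · rintro (_ | k)
    · exact Nat.zero_le _
    · exact hge _ _ fun i hi => hle k i ((Nat.le_succ k).trans hi)
  · refine Filter.tendsto_atTop.2 fun n => ?_
    obtain ⟨K, hK⟩ := Filter.eventually_atTop.1 (hlim.eventually_ge_atTop n)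
    refine Filter.eventually_atTop.2 ⟨K + 1, fun k hk => ?_⟩
    obtain ⟨k, rfl⟩ : ∃ k', k = k' + 1 := ⟨k - 1, by omega⟩
    exact hge _ _ fun i hi => hK i (by omega)

/-- An asynchronous run whose head on tape `j₀` tends to infinity is simulated by a run of the
simulating machine whose head tends to infinity. -/
theorem exists_sim_run {tr : Q → J → Γ → Q → Γ → Move → Prop} {j₀ : J} {blank : Γ}
    {y : ℕ → TapesConf Q Γ J} (hy : ∀ k, ∃ j, AsyncStep tr j (y k) (y (k + 1)))
    (hlim : Filter.Tendsto (fun k => (y k).pos j₀) Filter.atTop Filter.atTop)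
    {E : Set (Mark J)} {T : ℕ → Cell Γ J} {p ℓ : ℕ}
    (h₀ : SimRel j₀ blank 0 ⟨.place (y 0).st E, T, p⟩ (y 0, ℓ)) :
    ∃ (x : ℕ → SimConf Q Γ J) (κ : ℕ → ℕ), x 0 = ⟨.place (y 0).st E, T, p⟩ ∧ IsStutter κ ∧
      (∀ i, (x i).st.st = (y (κ i)).st) ∧ (∀ i, SimStep tr j₀ (x i) (x (i + 1))) ∧
      Filter.Tendsto (fun i => (x i).pos) Filter.atTop Filter.atTop := by
  obtain ⟨β, hβ₀, hmono, hβlim, hβ⟩ := exists_monotone_minorant hlim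
  obtain ⟨x, κ, hx, hκ, hP⟩ := exists_concatenated_run (SimStep tr j₀)
    (fun k x => ∃ E T p ℓ, x = ⟨.place (y k).st E, T, p⟩ ∧ SimRel j₀ blank (β k) x (y k, ℓ))
    (fun k x => x.st.st = (y k).st ∧ β k ≤ x.pos)
    (x₀ := ⟨.place (y 0).st E, T, p⟩) ⟨E, T, p, ℓ, rfl, by rwa [hβ₀]⟩ (by
      rintro k _ ⟨E, T, p, ℓ, rfl, h⟩
      obtain ⟨j, hj⟩ := hy k
      obtain ⟨E', T', p', ℓ', h', path⟩ :=
        h.exists_path hj (hmono (Nat.le_succ k)) (hβ k).1 (hβ k).2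
      exact ⟨_, ⟨E', T', p', ℓ', rfl, h'⟩, path⟩)
  exact ⟨x, κ, hx, hκ, fun i => (hP i).1.1, fun i => (hP i).2,
    Filter.tendsto_atTop_mono (fun i => (hP i).1.2) (hβlim.comp hκ.tendsto)⟩

end Simulation

/-! ### Serialization

A multi-tape machine is turned into an asynchronous machine which guesses an instruction of the
multi-tape machine and carries it out tape by tape, treating the first tape last. -/

instance : Finite Move :=
  Finite.of_injective (β := Fin 3) (fun | .L => 0 | .R => 1 | .S => 2)
    (by rintro (_ | _ | _) (_ | _ | _) h <;> simp_all)

/-- What a transition of an `m`-tape machine reads and what it does. -/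
structure Instr (Q Γ : Type) (m : ℕ) where
  read : Fin m → Γ
  next : Q
  write : Fin m → Γ
  move : Fin m → Move

instance {Q Γ : Type} {m : ℕ} [Finite Q] [Finite Γ] : Finite (Instr Q Γ m) :=
  Finite.of_injective (fun t : Instr Q Γ m => (t.read, t.next, t.write, t.move)) (by
    rintro ⟨_, _, _, _⟩ ⟨_, _, _, _⟩ h
    simp_all)

section Serialization

variable {Q Γ : Type} {m : ℕ}

/-- A step of an `m`-tape machine. -/
def SyncStep (tr : Q → (Fin m → Γ) → Q → (Fin m → Γ) → (Fin m → Move) → Prop)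
    (y y' : TapesConf Q Γ (Fin m)) : Prop :=
  ∃ g mv, tr y.st (fun j => y.tape j (y.pos j)) y'.st g mv ∧
    (∀ j, y'.tape j = Function.update (y.tape j) (y.pos j) (g j)) ∧
    ∀ j, y'.pos j = moveHead (mv j) (y.pos j)

/-- States of the serialized machine: the state of the multi-tape machine together with the
instruction being carried out, if any, and the tape to be treated next. -/
abbrev SerialState (Q Γ : Type) (m : ℕ) : Type := Q × Option (Instr Q Γ m × Fin m)

/-- In state `s` the serialized machine may treat tape `j` according to the instruction `t`. -/
def Active (tr : Q → (Fin m → Γ) → Q → (Fin m → Γ) → (Fin m → Move) → Prop)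
    (s : SerialState Q Γ m) (t : Instr Q Γ m) (j : Fin m) : Prop :=
  s.2 = some (t, j) ∨
    s.2 = none ∧ (j : ℕ) + 1 = m ∧ tr s.1 t.read t.next t.write t.move

/-- The state after treating tape `j` according to the instruction `t`. -/
def serialNext (q : Q) (t : Instr Q Γ m) (j : Fin m) : SerialState Q Γ m :=
  if (j : ℕ) = 0 then (t.next, none)
  else (q, some (t, ⟨j - 1, (Nat.sub_le _ _).trans_lt j.2⟩))

/-- The transition relation of the serialized machine. -/
def SerialTrans (tr : Q → (Fin m → Γ) → Q → (Fin m → Γ) → (Fin m → Move) → Prop)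
    (s : SerialState Q Γ m) (j : Fin m) (a : Γ) (s' : SerialState Q Γ m) (g : Γ) (d : Move) :
    Prop :=
  ∃ t, Active tr s t j ∧ a = t.read j ∧ s' = serialNext s.1 t j ∧ g = t.write j ∧ d = t.move j

/-- `x` arises from `y` by carrying out the instruction `t` on the tapes `i` with `n ≤ i`. -/
structure PartlyDone (t : Instr Q Γ m) (n : ℕ) (x : TapesConf (SerialState Q Γ m) Γ (Fin m))
    (y : TapesConf Q Γ (Fin m)) : Prop where
  read : ∀ i : Fin m, n ≤ i → y.tape i (y.pos i) = t.read i
  tape : ∀ i : Fin m, n ≤ i → x.tape i = Function.update (y.tape i) (y.pos i) (t.write i)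
  pos : ∀ i : Fin m, n ≤ i → x.pos i = moveHead (t.move i) (y.pos i)
  tape_eq : ∀ i : Fin m, (i : ℕ) < n → x.tape i = y.tape i
  pos_eq : ∀ i : Fin m, (i : ℕ) < n → x.pos i = y.pos i

lemma PartlyDone.step {t : Instr Q Γ m} {j : Fin m}
    {x x' : TapesConf (SerialState Q Γ m) Γ (Fin m)} {y : TapesConf Q Γ (Fin m)}
    (h : PartlyDone t (j + 1) x y) (hread : x.tape j (x.pos j) = t.read j)
    (htape : x'.tape = Function.update x.tape j (Function.update (x.tape j) (x.pos j) (t.write j)))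
    (hpos : x'.pos = Function.update x.pos j (moveHead (t.move j) (x.pos j))) :
    PartlyDone t j x' y := by
  have htj := h.tape_eq j (Nat.lt_succ_self _)
  have hpj := h.pos_eq j (Nat.lt_succ_self _)
  have hlt : ∀ i : Fin m, (j : ℕ) ≤ i → i ≠ j → (j : ℕ) + 1 ≤ i := fun i hi hne =>
    Nat.lt_of_le_of_ne hi fun e => hne (Fin.ext e.symm)
  have hne : ∀ i : Fin m, (i : ℕ) < j → i ≠ j := fun i hi e => hi.ne (e ▸ rfl)
  constructor
  · intro i hi
    by_cases hij : i = j
    · rw [hij, ← hread, htj, hpj]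
    · exact h.read i (hlt i hi hij)
  · intro i hi
    by_cases hij : i = j
    · rw [hij, htape, Function.update_self, htj, hpj]
    · rw [htape, Function.update_of_ne hij, h.tape i (hlt i hi hij)]
  · intro i hi
    by_cases hij : i = j
    · rw [hij, hpos, Function.update_self, hpj]
    · rw [hpos, Function.update_of_ne hij, h.pos i (hlt i hi hij)]
  · intro i hi
    rw [htape, Function.update_of_ne (hne i hi), h.tape_eq i (hi.trans (Nat.lt_succ_self _))]
  · intro i hi
    rw [hpos, Function.update_of_ne (hne i hi), h.pos_eq i (hi.trans (Nat.lt_succ_self _))]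

/-- The configuration `x` of the serialized machine represents `y`. -/
def SerialRel (tr : Q → (Fin m → Γ) → Q → (Fin m → Γ) → (Fin m → Move) → Prop)
    (x : TapesConf (SerialState Q Γ m) Γ (Fin m)) (y : TapesConf Q Γ (Fin m)) : Prop :=
  x.st.1 = y.st ∧
  match x.st.2 with
  | none => x.tape = y.tape ∧ x.pos = y.pos
  | some (t, j) => tr y.st t.read t.next t.write t.move ∧ PartlyDone t (j + 1) x y

lemma PartlyDone.of_eq {t : Instr Q Γ m} {n : ℕ} (hn : n = m)
    {x : TapesConf (SerialState Q Γ m) Γ (Fin m)} {y : TapesConf Q Γ (Fin m)}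
    (htape : x.tape = y.tape) (hpos : x.pos = y.pos) : PartlyDone t n x y := by
  subst hn
  exact ⟨fun i hi => absurd i.2 (not_lt.2 hi), fun i hi => absurd i.2 (not_lt.2 hi),
    fun i hi => absurd i.2 (not_lt.2 hi), fun i _ => by rw [htape], fun i _ => by rw [hpos]⟩

lemma SerialRel.partlyDone {tr : Q → (Fin m → Γ) → Q → (Fin m → Γ) → (Fin m → Move) → Prop}
    {x : TapesConf (SerialState Q Γ m) Γ (Fin m)} {y : TapesConf Q Γ (Fin m)}
    (h : SerialRel tr x y) {t : Instr Q Γ m} {j : Fin m} (hA : Active tr x.st t j) :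
    tr y.st t.read t.next t.write t.move ∧ PartlyDone t (j + 1) x y := by
  obtain ⟨hst, h⟩ := h
  rcases hA with hA | ⟨hA, hj, htr⟩ <;> rw [hA] at h
  · exact h
  · exact ⟨hst ▸ htr, .of_eq hj h.1 h.2⟩

/-- A measure which decreases while an instruction is being carried out. -/
def SerialState.rank (s : SerialState Q Γ m) : ℕ :=
  match s.2 with
  | none => m
  | some (_, j) => j

lemma Active.le_rank {tr : Q → (Fin m → Γ) → Q → (Fin m → Γ) → (Fin m → Move) → Prop}
    {s : SerialState Q Γ m} {t : Instr Q Γ m} {j : Fin m} (h : Active tr s t j) :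
    (j : ℕ) ≤ s.rank := by
  rcases h with h | ⟨h, -⟩ <;> simp only [SerialState.rank, h]
  exacts [le_rfl, j.2.le]

/-- Every step of the serialized machine keeps the simulated configuration or advances it. -/
lemma SerialRel.step {tr : Q → (Fin m → Γ) → Q → (Fin m → Γ) → (Fin m → Move) → Prop}
    {x x' : TapesConf (SerialState Q Γ m) Γ (Fin m)} {y : TapesConf Q Γ (Fin m)} {j : Fin m}
    (h : SerialRel tr x y) (hx : AsyncStep (SerialTrans tr) j x x') :
    (SerialRel tr x' y ∧ x'.st.rank < x.st.rank) ∨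
      ∃ y', (SyncStep tr y y' ∧ (j : ℕ) = 0 ∧ x.pos j = y.pos j) ∧ SerialRel tr x' y' := by
  obtain ⟨_, _, ⟨t, hA, hread, hnext, rfl, rfl⟩, htape, hpos⟩ := hx
  obtain ⟨htr, hdone⟩ := h.partlyDone hA
  have hdone' := hdone.step hread htape hpos
  rw [serialNext] at hnext
  split_ifs at hnext with hj
  · rw [hj] at hdone'
    refine Or.inr ⟨⟨t.next, x'.tape, x'.pos⟩, ⟨⟨t.write, t.move, ?_, fun i => ?_, fun i => ?_⟩, hj,
      hdone.pos_eq j (Nat.lt_succ_self _)⟩, ?_⟩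
    · convert htr using 1
      exact funext fun i => hdone'.read i (Nat.zero_le _)
    · exact hdone'.tape i (Nat.zero_le _)
    · exact hdone'.pos i (Nat.zero_le _)
    · simp [SerialRel, hnext]
  · have hj' : (j : ℕ) - 1 + 1 = j := Nat.sub_add_cancel (Nat.pos_of_ne_zero hj)
    refine Or.inl ⟨?_, ?_⟩
    · simp only [SerialRel, hnext, hj']
      exact ⟨h.1, htr, hdone'⟩
    · have := hA.le_rank
      simp only [SerialState.rank, hnext] at this ⊢
      omega

/-- An asynchronous run of the serialized machine which operates on any given cell of the first tape
only finitely often yields a run of the multi-tape machine whose first head tends to infinity. -/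
theorem exists_sync_run {tr : Q → (Fin m → Γ) → Q → (Fin m → Γ) → (Fin m → Move) → Prop}
    (hm : 0 < m) {x : ℕ → TapesConf (SerialState Q Γ m) Γ (Fin m)} {j : ℕ → Fin m}
    {y₀ : TapesConf Q Γ (Fin m)} (h₀ : SerialRel tr (x 0) y₀)
    (hx : ∀ i, AsyncStep (SerialTrans tr) (j i) (x i) (x (i + 1)))
    (hlim : ∀ N, ∃ K, ∀ k, K ≤ k → j k = ⟨0, hm⟩ → N ≤ (x k).pos ⟨0, hm⟩) :
    ∃ (y : ℕ → TapesConf Q Γ (Fin m)) (κ : ℕ → ℕ), y 0 = y₀ ∧ IsStutter κ ∧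
      (∀ i, (x i).st.1 = (y (κ i)).st) ∧ (∀ k, SyncStep tr (y k) (y (k + 1))) ∧
      Filter.Tendsto (fun k => (y k).pos ⟨0, hm⟩) Filter.atTop Filter.atTop := by
  obtain ⟨y, κ, hy, hκ, hR, hH⟩ := exists_simulated_run (fun i => (x i, j i))
    (fun x y => SerialRel tr x.1 y) (fun x x' => x'.1.st.rank < x.1.st.rank)
    (fun x y y' => SyncStep tr y y' ∧ (x.2 : ℕ) = 0 ∧ x.1.pos x.2 = y.pos x.2)
    h₀ (fun i y h => h.step (hx i)) (fun i₀ y h => by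
      have hlt : ∀ n, (x (i₀ + n)).st.rank + n ≤ (x i₀).st.rank := by
        intro n
        induction n with
        | zero => rfl
        | succ n ih =>
          have := (h (i₀ + n) (Nat.le_add_right _ _)).2
          dsimp only at this
          rw [← add_assoc i₀]
          omega
      have := hlt ((x i₀).st.rank + 1)
      omega)
  refine ⟨y, κ, hy, hκ, fun i => (hR i).1, fun k => (hH k).choose_spec.2.1,
    Filter.tendsto_atTop.2 fun N => ?_⟩
  obtain ⟨K, hK⟩ := hlim N
  refine Filter.eventually_atTop.2 ⟨K, fun k hk => ?_⟩
  obtain ⟨i, hi, -, hj, hpos⟩ := hH k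
  have hj' : j i = ⟨0, hm⟩ := Fin.ext hj
  dsimp only at hpos
  rw [hj'] at hpos
  exact hpos ▸ hK i (hk.trans hi) hj'

/-- The serialized machine can complete the instruction being carried out. -/
lemma PartlyDone.exists_path {tr : Q → (Fin m → Γ) → Q → (Fin m → Γ) → (Fin m → Move) → Prop}
    (hm : 0 < m) {t : Instr Q Γ m} {y y' : TapesConf Q Γ (Fin m)}
    (hread : ∀ i, y.tape i (y.pos i) = t.read i) (hst : y'.st = t.next)
    (htape : ∀ i, y'.tape i = Function.update (y.tape i) (y.pos i) (t.write i))
    (hpos : ∀ i, y'.pos i = moveHead (t.move i) (y.pos i)) (n : ℕ) :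
    ∀ {x : TapesConf (SerialState Q Γ m) Γ (Fin m)} (hn : n < m),
    PartlyDone t (n + 1) x y → x.st.1 = y.st → Active tr x.st t ⟨n, hn⟩ →
    Relation.TransGen
      (fun a b => (a.st.1 = y.st ∧ a.pos ⟨0, hm⟩ = y.pos ⟨0, hm⟩) ∧
        ∃ j, AsyncStep (SerialTrans tr) j a b) x ⟨(y'.st, none), y'.tape, y'.pos⟩ := by
  induction n with
  | zero =>
    intro x hn h hx hA
    have hp := h.pos_eq ⟨0, hn⟩ (Nat.lt_succ_self _)
    have ht := h.tape_eq ⟨0, hn⟩ (Nat.lt_succ_self _)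
    have hr : x.tape ⟨0, hn⟩ (x.pos ⟨0, hn⟩) = t.read ⟨0, hn⟩ := by rw [ht, hp, hread]
    have h' := h.step (j := ⟨0, hn⟩) (x' := ⟨serialNext x.st.1 t ⟨0, hn⟩, _, _⟩) hr rfl rfl
    refine .single ⟨⟨hx, hp⟩, ⟨0, hn⟩, _, _, ⟨t, hA, hr, by simp [serialNext, hst], rfl, rfl⟩,
      ?_, ?_⟩
    · exact funext fun i => (htape i).trans (h'.tape i (Nat.zero_le _)).symm
    · exact funext fun i => (hpos i).trans (h'.pos i (Nat.zero_le _)).symm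
  | succ n ih =>
    intro x hn h hx hA
    have hp := h.pos_eq ⟨n + 1, hn⟩ (Nat.lt_succ_self _)
    have ht := h.tape_eq ⟨n + 1, hn⟩ (Nat.lt_succ_self _)
    have hr : x.tape ⟨n + 1, hn⟩ (x.pos ⟨n + 1, hn⟩) = t.read ⟨n + 1, hn⟩ := by rw [ht, hp, hread]
    have h' := h.step (j := ⟨n + 1, hn⟩) (x' := ⟨serialNext x.st.1 t ⟨n + 1, hn⟩, _, _⟩) hr rfl rfl
    exact (ih (Nat.lt_of_succ_lt hn) h' (by simpa [serialNext] using hx)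
      (Or.inl (by simp [serialNext]))).head
      ⟨⟨hx, h.pos_eq _ (Nat.succ_pos _)⟩, ⟨n + 1, hn⟩, _, _, ⟨t, hA, hr, rfl, rfl, rfl⟩, rfl, rfl⟩

/-- A run of the multi-tape machine yields a run of the serialized machine. -/
theorem exists_serial_run {tr : Q → (Fin m → Γ) → Q → (Fin m → Γ) → (Fin m → Move) → Prop}
    (hm : 0 < m) {y : ℕ → TapesConf Q Γ (Fin m)} (hy : ∀ k, SyncStep tr (y k) (y (k + 1)))
    (hlim : Filter.Tendsto (fun k => (y k).pos ⟨0, hm⟩) Filter.atTop Filter.atTop) :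
    ∃ (x : ℕ → TapesConf (SerialState Q Γ m) Γ (Fin m)) (κ : ℕ → ℕ),
      x 0 = ⟨((y 0).st, none), (y 0).tape, (y 0).pos⟩ ∧ IsStutter κ ∧
      (∀ i, (x i).st.1 = (y (κ i)).st) ∧
      (∀ i, ∃ j, AsyncStep (SerialTrans tr) j (x i) (x (i + 1))) ∧
      Filter.Tendsto (fun i => (x i).pos ⟨0, hm⟩) Filter.atTop Filter.atTop := by
  obtain ⟨x, κ, hx, hκ, hP⟩ := exists_concatenated_run
    (fun a b => ∃ j, AsyncStep (SerialTrans tr) j a b)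
    (fun k x => x = ⟨((y k).st, none), (y k).tape, (y k).pos⟩)
    (fun k x => x.st.1 = (y k).st ∧ x.pos ⟨0, hm⟩ = (y k).pos ⟨0, hm⟩) rfl (by
      rintro k _ rfl
      obtain ⟨g, mv, htr, htape, hpos⟩ := hy k
      have hm' : m - 1 + 1 = m := Nat.sub_add_cancel hm
      exact ⟨_, rfl, PartlyDone.exists_path hm
        (t := ⟨fun j => (y k).tape j ((y k).pos j), (y (k + 1)).st, g, mv⟩)
        (fun _ => rfl) rfl htape hpos (m - 1) (by omega) (.of_eq hm' rfl rfl) rfl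
        (Or.inr ⟨rfl, hm', htr⟩)⟩)
  refine ⟨x, κ, hx, hκ, fun i => (hP i).1.1, fun i => (hP i).2, ?_⟩
  exact (hlim.comp hκ.tendsto).congr fun i => (hP i).1.2.symm

end Serialization

/-! ### Equivalence of multi-tape and single-tape machines -/

/-- A run is complete and non-oscillating iff the head position tends to infinity. -/
lemma tendsto_atTop_iff_complete_nonoscillating {pos : ℕ → ℕ} :
    Filter.Tendsto pos Filter.atTop Filter.atTop ↔
      (∀ n, ∃ i, n ≤ pos i) ∧ ∀ n, ∃ i₀, ∀ i, i₀ ≤ i → pos i ≠ n := by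
  constructor
  · intro h
    refine ⟨fun n => (h.eventually_ge_atTop n).exists, fun n => ?_⟩
    obtain ⟨i₀, hi₀⟩ := Filter.eventually_atTop.1 (h.eventually_gt_atTop n)
    exact ⟨i₀, fun i hi => (hi₀ i hi).ne'⟩
  · rintro ⟨-, h⟩
    refine Filter.tendsto_atTop.2 fun n => ?_
    have : ∀ᶠ i in Filter.atTop, ∀ k ∈ Finset.range n, pos i ≠ k :=
      (Finset.eventually_all _).2 fun k _ => Filter.eventually_atTop.2 (h k)
    filter_upwards [this] with i hi
    by_contra hlt
    exact hi _ (Finset.mem_range.2 (not_le.1 hlt)) rfl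

section Machines

variable {Sig : Type} {m : ℕ}

/-- The state of the multi-tape machine which is simulated by a state of the single-tape
machine. -/
def simulatedState {Q Γ : Type} (s : SimState (SerialState Q Γ m) Γ (Fin m)) : Q := s.st.1

lemma simulatedState_surjective {Q Γ : Type} :
    Function.Surjective (simulatedState : SimState (SerialState Q Γ m) Γ (Fin m) → Q) :=
  fun q => ⟨.seek (q, none), rfl⟩

/-- The single-tape machine simulating a multi-tape machine. -/
noncomputable abbrev OmegaMTM.toTM (M : OmegaMTM m Sig) (hm : 0 < m) : OmegaTM Sig :=
  letI := M.fintypeQ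
  letI := M.fintypeΓ
  { Q := SimState (SerialState M.Q M.Γ m) M.Γ (Fin m)
    fintypeQ := Fintype.ofFinite _
    Γ := Cell M.Γ (Fin m)
    fintypeΓ := Fintype.ofFinite _
    embed := fun s => ⟨fun j => if j = ⟨0, hm⟩ then M.embed s else M.blank, ∅⟩
    embed_inj := fun s s' h => M.embed_inj (by
      simpa using congrFun (congrArg Cell.sym h) ⟨0, hm⟩)
    init := .place (M.init, none) Set.univ
    trans := SimTrans (SerialTrans M.trans) ⟨0, hm⟩
    acc := {F | simulatedState '' F ∈ M.acc} }

/-- The initial configuration of a multi-tape machine. -/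
def OmegaMTM.initConf (M : OmegaMTM m Sig) (hm : 0 < m) (u : ℕ → Sig) :
    TapesConf M.Q M.Γ (Fin m) :=
  ⟨M.init, fun j n => if j = ⟨0, hm⟩ then M.embed (u n) else M.blank, fun _ => 0⟩

lemma OmegaMTM.mem_lang_iff (M : OmegaMTM m Sig) (hm : 0 < m) (σ : AccSigma) (ρ : AccRho)
    (u : ℕ → Sig) :
    u ∈ M.Lang hm σ ρ ↔ ∃ y : ℕ → TapesConf M.Q M.Γ (Fin m), y 0 = M.initConf hm u ∧
      (∀ k, SyncStep M.trans (y k) (y (k + 1))) ∧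
      Filter.Tendsto (fun k => (y k).pos ⟨0, hm⟩) Filter.atTop Filter.atTop ∧
      IsAccepting σ ρ M.acc (fun k => (y k).st) := by
  constructor
  · rintro ⟨q, tape, pos, hq, hinput, hblank, hpos, hstep, hcomp, hosc, hacc⟩
    refine ⟨fun k => ⟨q k, tape k, pos k⟩, ?_, hstep,
      tendsto_atTop_iff_complete_nonoscillating.2 ⟨hcomp, hosc⟩, hacc⟩
    have htape : tape 0 = (M.initConf hm u).tape := by
      funext j n
      by_cases hj : j = ⟨0, hm⟩
      · simp [initConf, hj, hinput]
      · simp [initConf, hj, hblank]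
    simp only [hq, htape, show pos 0 = fun _ => 0 from funext hpos]
    rfl
  · rintro ⟨y, hy, hstep, hlim, hacc⟩
    obtain ⟨hcomp, hosc⟩ := tendsto_atTop_iff_complete_nonoscillating.1 hlim
    refine ⟨fun k => (y k).st, fun k => (y k).tape, fun k => (y k).pos, ?_, ?_, ?_, ?_, hstep,
      hcomp, hosc, hacc⟩ <;> simp only [hy, initConf]
    · simp
    · intro j hj
      simp [hj]
    · simp

lemma OmegaMTM.mem_lang_toTM_iff (M : OmegaMTM m Sig) (hm : 0 < m) (σ : AccSigma) (ρ : AccRho)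
    (u : ℕ → Sig) :
    u ∈ (M.toTM hm).Lang σ ρ ↔
      ∃ x : ℕ → SimConf (SerialState M.Q M.Γ m) M.Γ (Fin m),
        x 0 = ⟨.place (M.init, none) Set.univ, fun n => (M.toTM hm).embed (u n), 0⟩ ∧
        (∀ i, SimStep (SerialTrans M.trans) ⟨0, hm⟩ (x i) (x (i + 1))) ∧
        Filter.Tendsto (fun i => (x i).pos) Filter.atTop Filter.atTop ∧
        IsAccepting σ ρ M.acc (fun i => (x i).st.st.1) := by
  have := (M.toTM hm).fintypeQ
  have hlift (f : ℕ → (M.toTM hm).Q) :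
      IsAccepting σ ρ (M.toTM hm).acc f ↔ IsAccepting σ ρ M.acc (simulatedState ∘ f) :=
    isAccepting_lift (Q' := (M.toTM hm).Q) simulatedState_surjective σ ρ M.acc f
  constructor
  · rintro ⟨q, tape, pos, hq, hinput, hpos, hstep, hcomp, hosc, hacc⟩
    refine ⟨fun k => ⟨q k, tape k, pos k⟩, ?_, hstep,
      tendsto_atTop_iff_complete_nonoscillating.2 ⟨hcomp, hosc⟩, (hlift q).1 hacc⟩
    simp only [hq, show tape 0 = _ from funext hinput, hpos]
  · rintro ⟨x, hx, hstep, hlim, hacc⟩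
    obtain ⟨hcomp, hosc⟩ := tendsto_atTop_iff_complete_nonoscillating.1 hlim
    exact ⟨fun k => (x k).st, fun k => (x k).tape, fun k => (x k).pos,
      congrArg SimConf.st hx, congrFun (congrArg SimConf.tape hx), congrArg SimConf.pos hx, hstep, hcomp, hosc, (hlift _).2 hacc⟩

/-- A multi-tape machine and the simulating single-tape machine accept the same language. -/
theorem OmegaMTM.lang_toTM (M : OmegaMTM m Sig) (hm : 0 < m) (σ : AccSigma) (ρ : AccRho) :
    M.Lang hm σ ρ = (M.toTM hm).Lang σ ρ := by
  ext u
  rw [M.mem_lang_iff, M.mem_lang_toTM_iff]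
  have hstart : SimRel ⟨0, hm⟩ M.blank 0
      ⟨.place (M.init, none) Set.univ, fun n => (M.toTM hm).embed (u n), 0⟩
      ((⟨(M.init, none), (M.initConf hm u).tape, (M.initConf hm u).pos⟩ :
        TapesConf (SerialState M.Q M.Γ m) M.Γ (Fin m)), 0) :=
    SimRel.init (y := ⟨(M.init, none), _, _⟩) (fun _ _ => rfl) (fun _ => rfl) (fun _ => rfl) fun j hj n => if_neg hj
  constructor
  · rintro ⟨y, hy, hstep, hlim, hacc⟩
    obtain ⟨z, κ, hz, hκ, hst, hstep', hlim'⟩ := exists_serial_run hm hstep hlim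
    have hz' : z 0 = ⟨(M.init, none), (M.initConf hm u).tape, (M.initConf hm u).pos⟩ := by
      rw [hz, hy]
      rfl
    obtain ⟨x, κ', hx, hκ', hst', hstep'', hlim''⟩ :=
      exists_sim_run (y := z) hstep' hlim' (by rw [hz']; exact hstart)
    refine ⟨x, by rw [hx, hz'], hstep'', hlim'', ?_⟩
    rw [show (fun i => (x i).st.st.1) = (fun k => (y k).st) ∘ (κ ∘ κ') from
      funext fun i => by rw [hst', hst]; rfl]
    exact hκ.comp hκ' |>.isAccepting_comp _ _ _ _ |>.2 hacc
  · rintro ⟨x, hx, hstep, hlim, hacc⟩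
    obtain ⟨z, j, κ, hz, hκ, hst, hstep', hlim'⟩ := exists_async_run (hx ▸ hstart) hstep hlim
    obtain ⟨y, κ', hy, hκ', hst', hstep'', hlim''⟩ :=
      exists_sync_run (y₀ := M.initConf hm u) hm (by rw [hz]; exact ⟨rfl, rfl, rfl⟩) hstep' hlim'
    refine ⟨y, hy, hstep'', hlim'', ?_⟩
    rw [show (fun i => (x i).st.st.1) = (fun k => (y k).st) ∘ (κ' ∘ κ) from
      funext fun i => by rw [hst, hst']; rfl] at hacc
    exact hκ'.comp hκ |>.isAccepting_comp _ _ _ _ |>.1 hacc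

/-- A single-tape machine as a multi-tape machine which ignores all tapes but the first. -/
abbrev OmegaTM.toMTM (M : OmegaTM Sig) (hm : 0 < m) (blank : M.Γ) : OmegaMTM m Sig :=
  letI := M.fintypeQ
  letI := M.fintypeΓ
  { Q := M.Q
    Γ := M.Γ
    embed := M.embed
    embed_inj := M.embed_inj
    blank := blank
    init := M.init
    trans := fun q a q' g mv => M.trans q (a ⟨0, hm⟩) q' (g ⟨0, hm⟩) (mv ⟨0, hm⟩)
    acc := M.acc }

theorem OmegaTM.lang_toMTM (M : OmegaTM Sig) (hm : 0 < m) (blank : M.Γ) (σ : AccSigma)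
    (ρ : AccRho) : (M.toMTM hm blank).Lang hm σ ρ = M.Lang σ ρ := by
  ext u
  constructor
  · rintro ⟨q, tape, pos, hq, hinput, -, hpos, hstep, hcomp, hosc, hacc⟩
    refine ⟨q, fun k => tape k ⟨0, hm⟩, fun k => pos k ⟨0, hm⟩, hq, hinput, hpos _, fun i => ?_,
      hcomp, hosc, hacc⟩
    obtain ⟨g, mv, htr, htape, hpos⟩ := hstep i
    exact ⟨g ⟨0, hm⟩, mv ⟨0, hm⟩, htr, htape _, hpos _⟩
  · rintro ⟨q, tape, pos, hq, hinput, hpos, hstep, hcomp, hosc, hacc⟩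
    refine ⟨q, fun k j => if j = ⟨0, hm⟩ then tape k else fun _ => blank,
      fun k j => if j = ⟨0, hm⟩ then pos k else 0, hq, ?_, ?_, ?_, fun i => ?_, ?_, ?_, hacc⟩
    · simpa using hinput
    · intro j hj n
      simp only [hj, if_false]
    · simp [hpos]
    · obtain ⟨g, d, htr, htape, hpos⟩ := hstep i
      refine ⟨fun j => if j = ⟨0, hm⟩ then g else blank, fun j => if j = ⟨0, hm⟩ then d else .S,
        by simpa [toMTM] using htr, fun j => ?_, fun j => ?_⟩ <;> by_cases hj : j = ⟨0, hm⟩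
      · simpa [hj] using htape
      · simp [hj]
      · simpa [hj] using hpos
      · simp [hj, moveHead]
    · simpa using hcomp
    · simpa using hosc

end Machines

end OmegaFormal

/-- Theorem: for every m ≥ 1 and every m-tape Turing ω-machine M there is a
(σ,ρ)-equivalent single-tape Turing ω-machine M' (for all (σ,ρ) simultaneously);
consequently 𝓛_{σ,ρ}(m-ω-TM) = 𝓛_{σ,ρ}(ω-TM) for every (σ,ρ). -/
theorem mtm_eq_tm (Sig : Type) [Fintype Sig] (m : ℕ) (hm : 1 ≤ m) :
    (∀ M : OmegaMTM m Sig, ∃ M' : OmegaTM Sig,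
      ∀ (σ : AccSigma) (ρ : AccRho), M.Lang hm σ ρ = M'.Lang σ ρ) ∧
    ∀ (σ : AccSigma) (ρ : AccRho), MTMLang Sig m hm σ ρ = TMLang Sig σ ρ := by
  refine ⟨fun M => ⟨M.toTM hm, fun σ ρ => M.lang_toTM hm σ ρ⟩, fun σ ρ => Set.ext fun L => ⟨?_, ?_⟩⟩
  · rintro ⟨M, rfl⟩
    exact ⟨M.toTM hm, M.lang_toTM hm σ ρ⟩
  · rintro ⟨M, rfl⟩
    rcases isEmpty_or_nonempty Sig with hSig | ⟨⟨s⟩⟩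
    · exact ⟨⟨Unit, Unit, fun _ => (), Function.injective_of_subsingleton _, (), (),
        fun _ _ _ _ _ => False, ∅⟩, Subsingleton.elim _ _⟩
    · exact ⟨M.toMTM hm (M.embed s), (M.lang_toMTM hm _ σ ρ).symm⟩
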